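/- arXiv:2404.10959 — 7 statements merged into one kernel-verified Lean document; each statement's English description precedes it below -/
import Mathlib

section
/- Let n ≥ 1, let ε ∈ [0,1], and let A ∈ ℂ^{n×n} be a Hermitian matrix with 0 ⪯ A ⪯ I and tr(A) ≤ (1−ε)n. Then per(A) is a nonnegative real number and per(A) ≤ (1 − ε²/20)^n. -/
open scoped BigOperators ComplexOrder

/-- The permanent of a complex square matrix. -/
noncomputable def perm {n : ℕ} (A : Matrix (Fin n) (Fin n) ℂ) : ℂ :=
  ∑ σ : Equiv.Perm (Fin n), ∏ i, A i (σ i)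

/-- sign of a boolean -/
def sg (b : Bool) : ℝ := if b then 1 else -1

lemma sg_sq (b : Bool) : sg b * sg b = 1 := by cases b <;> simp [sg]

/-- Key bound on the exponential moment of a quadratic form in random signs. -/
lemma key : ∀ (n : ℕ) (Q : Fin n → Fin n → ℝ), (∀ i j, Q i j = Q j i) →
    (∀ v : Fin n → ℝ, 0 ≤ ∑ i, ∑ j, Q i j * v i * v j) →
    (∀ v : Fin n → ℝ, ∑ i, ∑ j, Q i j * v i * v j ≤ ∑ i, v i ^ 2) →
    ∑ x : Fin n → Bool, Real.exp (-(∑ i, ∑ j, Q i j * sg (x i) * sg (x j)) / 2)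
      ≤ 2 ^ n * Real.exp (-(∑ i, Q i i) / 4) := by
  intro n
  induction n with
  | zero => intro Q _ _ _; simp
  | succ n ih =>
    intro Q hs h0 h1
    -- expansion of the form
    have hexp : ∀ (t : ℝ) (v : Fin n → ℝ),
        ∑ i, ∑ j, Q i j * (Fin.cons t v : Fin (n+1) → ℝ) i * (Fin.cons t v : Fin (n+1) → ℝ) j
        = Q 0 0 * t ^ 2 + 2 * t * (∑ i, Q 0 i.succ * v i)
          + ∑ i : Fin n, ∑ j : Fin n, Q i.succ j.succ * v i * v j := by
      intro t v
      simp only [Fin.sum_univ_succ, Fin.cons_zero, Fin.cons_succ, Finset.sum_add_distrib]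
      have e1 : ∑ i : Fin n, Q 0 i.succ * t * v i = t * ∑ i, Q 0 i.succ * v i := by
        rw [Finset.mul_sum]; exact Finset.sum_congr rfl fun i _ => by ring
      have e2 : ∑ i : Fin n, Q i.succ 0 * v i * t = t * ∑ i, Q 0 i.succ * v i := by
        rw [Finset.mul_sum]; exact Finset.sum_congr rfl fun i _ => by rw [hs i.succ 0]; ring
      rw [e1, e2]; ring
    have hnorm : ∀ (t : ℝ) (v : Fin n → ℝ),
        ∑ i, (Fin.cons t v : Fin (n+1) → ℝ) i ^ 2 = t ^ 2 + ∑ i, v i ^ 2 := by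
      intro t v
      simp [Fin.sum_univ_succ]
    have H0 : ∀ (t : ℝ) (v : Fin n → ℝ), 0 ≤ Q 0 0 * t ^ 2 + 2 * t * (∑ i, Q 0 i.succ * v i)
          + ∑ i : Fin n, ∑ j : Fin n, Q i.succ j.succ * v i * v j := by
      intro t v; rw [← hexp]; exact h0 _
    have H1 : ∀ (t : ℝ) (v : Fin n → ℝ), Q 0 0 * t ^ 2 + 2 * t * (∑ i, Q 0 i.succ * v i)
          + ∑ i : Fin n, ∑ j : Fin n, Q i.succ j.succ * v i * v j ≤ t ^ 2 + ∑ i, v i ^ 2 := by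
      intro t v; rw [← hexp, ← hnorm]; exact h1 _
    have hq1 : Q 0 0 ≤ 1 := by simpa using H1 1 (fun _ => 0)
    have hform : ∀ v : Fin n → ℝ,
        ∑ i : Fin n, ∑ j : Fin n, (Q i.succ j.succ - Q 0 i.succ * Q 0 j.succ) * v i * v j
        = (∑ i : Fin n, ∑ j : Fin n, Q i.succ j.succ * v i * v j)
          - (∑ i, Q 0 i.succ * v i) ^ 2 := by
      intro v
      rw [sq, Finset.sum_mul_sum, ← Finset.sum_sub_distrib]
      refine Finset.sum_congr rfl fun i _ => ?_
      rw [← Finset.sum_sub_distrib]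
      exact Finset.sum_congr rfl fun j _ => by ring
    have IH := ih (fun i j => Q i.succ j.succ - Q 0 i.succ * Q 0 j.succ)
      (fun i j => by rw [hs i.succ j.succ]; ring)
      (fun v => by
        rw [hform]
        have := H0 (-(∑ i, Q 0 i.succ * v i)) v
        nlinarith [sq_nonneg (∑ i, Q 0 i.succ * v i)])
      (fun v => by
        rw [hform]
        have := H1 0 v
        nlinarith [sq_nonneg (∑ i, Q 0 i.succ * v i)])
    have hp : ∑ i : Fin n, Q 0 i.succ ^ 2 ≤ Q 0 0 - Q 0 0 ^ 2 := by
      have a := H0 (-(1 - Q 0 0)) (fun i => Q 0 i.succ)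
      have b := H1 (Q 0 0) (fun i => Q 0 i.succ)
      have e : ∑ i : Fin n, Q 0 i.succ * Q 0 i.succ = ∑ i : Fin n, Q 0 i.succ ^ 2 :=
        Finset.sum_congr rfl fun i _ => by ring
      simp only [e] at a b
      nlinarith
    have hsum : ∑ x : Fin (n+1) → Bool, Real.exp (-(∑ i, ∑ j, Q i j * sg (x i) * sg (x j)) / 2)
        = ∑ y : Fin n → Bool, ∑ b : Bool, Real.exp (-(Q 0 0 * sg b ^ 2
          + 2 * sg b * (∑ i, Q 0 i.succ * sg (y i))
          + ∑ i : Fin n, ∑ j : Fin n, Q i.succ j.succ * sg (y i) * sg (y j)) / 2) := by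
      rw [Finset.sum_comm, ← Fintype.sum_prod_type', ← (Fin.consEquiv (fun _ => Bool)).sum_comp]
      refine Finset.sum_congr rfl fun p _ => ?_
      rw [← hexp]
      have hc : ∀ i, sg (Fin.consEquiv (fun _ => Bool) p i)
          = (Fin.cons (sg p.1) (fun i => sg (p.2 i)) : Fin (n+1) → ℝ) i := by
        intro i
        refine Fin.cases ?_ (fun i => ?_) i <;> simp [Fin.consEquiv]
      simp only [hc]
    rw [hsum]
    have hstep : ∀ y : Fin n → Bool, ∑ b : Bool, Real.exp (-(Q 0 0 * sg b ^ 2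
          + 2 * sg b * (∑ i, Q 0 i.succ * sg (y i))
          + ∑ i : Fin n, ∑ j : Fin n, Q i.succ j.succ * sg (y i) * sg (y j)) / 2)
        ≤ 2 * Real.exp (-Q 0 0 / 2) * Real.exp (-(∑ i : Fin n, ∑ j : Fin n,
          (Q i.succ j.succ - Q 0 i.succ * Q 0 j.succ) * sg (y i) * sg (y j)) / 2) := by
      intro y
      rw [hform (fun i => sg (y i))]
      generalize (∑ i, Q 0 i.succ * sg (y i)) = B
      generalize (∑ i : Fin n, ∑ j : Fin n, Q i.succ j.succ * sg (y i) * sg (y j)) = R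
      have hc := Real.cosh_le_exp_half_sq B
      rw [Real.cosh_eq] at hc
      have e1 : Real.exp (-(Q 0 0 * sg true ^ 2 + 2 * sg true * B + R) / 2)
          = Real.exp (-Q 0 0 / 2) * Real.exp (-R/2) * Real.exp (-B) := by
        rw [← Real.exp_add, ← Real.exp_add]; congr 1; simp [sg]; ring
      have e2 : Real.exp (-(Q 0 0 * sg false ^ 2 + 2 * sg false * B + R) / 2)
          = Real.exp (-Q 0 0 / 2) * Real.exp (-R/2) * Real.exp B := by
        rw [← Real.exp_add, ← Real.exp_add]; congr 1; simp [sg]; ring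
      have e3 : Real.exp (-(R - B ^ 2) / 2) = Real.exp (-R/2) * Real.exp (B^2/2) := by
        rw [← Real.exp_add]; congr 1; ring
      rw [Fintype.sum_bool, e1, e2, e3]
      have hpos : 0 < Real.exp (-Q 0 0 / 2) * Real.exp (-R/2) := by positivity
      nlinarith
    refine (Finset.sum_le_sum fun y _ => hstep y).trans ?_
    rw [← Finset.mul_sum]
    refine (mul_le_mul_of_nonneg_left IH (by positivity)).trans ?_
    have e : 2 * Real.exp (-Q 0 0 / 2) * (2 ^ n * Real.exp (-(∑ i : Fin n,
        (Q i.succ i.succ - Q 0 i.succ * Q 0 i.succ)) / 4))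
        = 2 ^ (n+1) * Real.exp (-Q 0 0 / 2 + (-(∑ i : Fin n,
        (Q i.succ i.succ - Q 0 i.succ * Q 0 i.succ)) / 4)) := by
      rw [Real.exp_add]; ring
    rw [e]
    refine mul_le_mul_of_nonneg_left (Real.exp_le_exp.mpr ?_) (by positivity)
    rw [Finset.sum_sub_distrib, Fin.sum_univ_succ]
    have e' : ∑ i : Fin n, Q 0 i.succ * Q 0 i.succ = ∑ i : Fin n, Q 0 i.succ ^ 2 :=
        Finset.sum_congr rfl fun i _ => by ring
    rw [e']
    nlinarith [sq_nonneg (Q 0 0)]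

/-- character sums -/
lemma char_sum {n : ℕ} (f : Fin n → Fin n) :
    ∑ x : Fin n → Bool, ((∏ i, (sg (x i) : ℂ)) * ∏ i, (sg (x (f i)) : ℂ))
      = if Function.Bijective f then 2 ^ n else 0 := by
  split_ifs with hf
  · have : ∀ x : Fin n → Bool, ((∏ i, (sg (x i) : ℂ)) * ∏ i, (sg (x (f i)) : ℂ)) = 1 := by
      intro x
      rw [hf.prod_comp (fun i => (sg (x i) : ℂ)), ← Finset.prod_mul_distrib]
      refine Finset.prod_eq_one fun i _ => ?_
      exact_mod_cast sg_sq (x i)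
    simp [this]
  · have hns : ¬ Function.Surjective f := fun h => hf (Finite.surjective_iff_bijective.mp h)
    simp only [Function.Surjective, not_forall, not_exists] at hns
    obtain ⟨k, hk⟩ := hns
    let F : (Fin n → Bool) → (Fin n → Bool) := fun x => Function.update x k (!(x k))
    have hF : Function.Involutive F := by
      intro x; simp [F]
    have h2 := (Equiv.sum_comp (hF.toPerm F)
      (fun x : Fin n → Bool => ((∏ i, (sg (x i) : ℂ)) * ∏ i, (sg (x (f i)) : ℂ)))).symm
    have h3 : ∀ x : Fin n → Bool,
        ((∏ i, (sg (hF.toPerm F x i) : ℂ)) * ∏ i, (sg (hF.toPerm F x (f i)) : ℂ))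
        = -((∏ i, (sg (x i) : ℂ)) * ∏ i, (sg (x (f i)) : ℂ)) := by
      intro x
      have a : ∀ i, hF.toPerm F x (f i) = x (f i) := by
        intro i; simp [F, Function.update_of_ne (hk i)]
      have b : (∏ i, (sg (hF.toPerm F x i) : ℂ)) = -(∏ i, (sg (x i) : ℂ)) := by
        rw [← Finset.mul_prod_erase _ _ (Finset.mem_univ k),
          ← Finset.mul_prod_erase _ (fun i => (sg (x i) : ℂ)) (Finset.mem_univ k)]
        rw [← neg_mul]
        congr 1
        · simp only [Function.Involutive.coe_toPerm, F, Function.update_self]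
          cases x k <;> simp [sg]
        · refine Finset.prod_congr rfl fun i hi => ?_
          simp [F, Function.update_of_ne (Finset.ne_of_mem_erase hi)]
      simp only [a, b]; ring
    simp only [h3, Finset.sum_neg_distrib] at h2
    exact self_eq_neg.mp h2

lemma sum_bij {n : ℕ} (g : (Fin n → Fin n) → ℂ) :
    ∑ f : Fin n → Fin n, (if Function.Bijective f then g f else 0)
      = ∑ σ : Equiv.Perm (Fin n), g σ := by
  rw [← Finset.sum_filter]
  symm
  refine Finset.sum_bij (fun σ _ => ⇑σ) ?_ ?_ ?_ ?_
  · intro σ _; exact Finset.mem_filter.mpr ⟨Finset.mem_univ _, σ.bijective⟩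
  · intro σ _ τ _ h; exact Equiv.coe_fn_injective h
  · intro f hf
    exact ⟨Equiv.ofBijective f (Finset.mem_filter.mp hf).2, Finset.mem_univ _, rfl⟩
  · intro σ _; rfl

lemma glynn {n : ℕ} (A : Matrix (Fin n) (Fin n) ℂ) :
    ∑ x : Fin n → Bool, ((∏ i, (sg (x i) : ℂ)) * ∏ i, ∑ j, A i j * (sg (x j) : ℂ))
      = 2 ^ n * perm A := by
  have h : ∀ x : Fin n → Bool, ((∏ i, (sg (x i) : ℂ)) * ∏ i, ∑ j, A i j * (sg (x j) : ℂ))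
      = ∑ f : Fin n → Fin n, (∏ i, A i (f i)) *
        ((∏ i, (sg (x i) : ℂ)) * ∏ i, (sg (x (f i)) : ℂ)) := by
    intro x
    rw [Finset.prod_univ_sum, Fintype.piFinset_univ, Finset.mul_sum]
    refine Finset.sum_congr rfl fun f _ => ?_
    rw [Finset.prod_mul_distrib]; ring
  simp only [h]
  rw [Finset.sum_comm]
  simp only [← Finset.mul_sum, char_sum]
  rw [perm, Finset.mul_sum, ← sum_bij (fun f => 2 ^ n * ∏ i, A i (f i))]
  refine Finset.sum_congr rfl fun f _ => ?_
  split_ifs <;> ring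

open scoped MatrixOrder Matrix.Norms.L2Operator in
lemma psd_factor {n : ℕ} (A : Matrix (Fin n) (Fin n) ℂ) (hA : A.PosSemidef) :
    ∃ B : Matrix (Fin n) (Fin n) ℂ, A = B.conjTranspose * B :=
  CStarAlgebra.nonneg_iff_eq_star_mul_self.mp hA.nonneg

lemma perm_nonneg {n : ℕ} (A : Matrix (Fin n) (Fin n) ℂ) (hA : A.PosSemidef) :
    0 ≤ perm A := by
  obtain ⟨B, rfl⟩ := psd_factor A hA
  let g : (Fin n → Fin n) → ℂ := fun f => ∑ σ : Equiv.Perm (Fin n), ∏ i, B (f i) (σ i)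
  have hg : ∀ (f : Fin n → Fin n) (τ : Equiv.Perm (Fin n)), g (f ∘ τ) = g f := by
    intro f τ
    simp only [g]
    rw [← Equiv.sum_comp (Equiv.mulRight τ)]
    refine Finset.sum_congr rfl fun σ _ => ?_
    exact Equiv.prod_comp τ (fun i => B (f i) (σ i))
  have h1 : perm (B.conjTranspose * B) = ∑ f : Fin n → Fin n, (∏ i, star (B (f i) i)) * g f := by
    simp only [perm, Matrix.mul_apply, Matrix.conjTranspose_apply, Finset.prod_univ_sum,
      Fintype.piFinset_univ, g, Finset.mul_sum]
    rw [Finset.sum_comm]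
    refine Finset.sum_congr rfl fun f _ => Finset.sum_congr rfl fun σ _ => ?_
    rw [Finset.prod_mul_distrib]
  have h2 : ∀ τ : Equiv.Perm (Fin n), perm (B.conjTranspose * B)
      = ∑ f : Fin n → Fin n, (∏ i, star (B (f i) (τ i))) * g f := by
    intro τ
    rw [h1, ← Equiv.sum_comp (Equiv.arrowCongr τ (Equiv.refl (Fin n)))]
    refine Finset.sum_congr rfl fun f _ => ?_
    have e : (Equiv.arrowCongr τ (Equiv.refl (Fin n))) f = f ∘ τ.symm := by
      ext i; simp [Equiv.arrowCongr]
    rw [e, hg, ← Equiv.prod_comp τ]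
    simp
  have h3 : (Fintype.card (Equiv.Perm (Fin n)) : ℂ) * perm (B.conjTranspose * B)
      = ∑ f : Fin n → Fin n, star (g f) * g f := by
    have : ∑ τ : Equiv.Perm (Fin n), perm (B.conjTranspose * B)
        = ∑ f : Fin n → Fin n, star (g f) * g f := by
      rw [Finset.sum_congr rfl fun τ _ => h2 τ, Finset.sum_comm]
      refine Finset.sum_congr rfl fun f _ => ?_
      rw [← Finset.sum_mul]
      congr 1
      simp only [g, star_sum, star_prod]
    rw [← this]; simp
  have h4 : 0 ≤ ∑ f : Fin n → Fin n, star (g f) * g f :=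
    Finset.sum_nonneg fun f _ => star_mul_self_nonneg _
  have hc : (0:ℝ) < (Fintype.card (Equiv.Perm (Fin n)) : ℝ) := by
    exact_mod_cast Fintype.card_pos
  have hi : (0:ℂ) ≤ (((Fintype.card (Equiv.Perm (Fin n)) : ℝ)⁻¹ : ℝ) : ℂ) :=
    Complex.zero_le_real.mpr (inv_nonneg.mpr hc.le)
  have h5 := mul_nonneg hi h4
  rw [← h3, ← mul_assoc] at h5
  have e : (((Fintype.card (Equiv.Perm (Fin n)) : ℝ)⁻¹ : ℝ) : ℂ)
      * (Fintype.card (Equiv.Perm (Fin n)) : ℂ) = 1 := by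
    have := inv_mul_cancel₀ hc.ne'
    exact_mod_cast congrArg (fun r : ℝ => (r : ℂ)) this
  rwa [e, one_mul] at h5

lemma real_form {n : ℕ} (P : Matrix (Fin n) (Fin n) ℂ) (v : Fin n → ℝ) :
    (dotProduct (star (fun i => (v i : ℂ))) (P.mulVec (fun i => (v i : ℂ)))).re
      = ∑ i, ∑ j, (P i j).re * v i * v j := by
  simp only [dotProduct, Matrix.mulVec, Pi.star_apply, Finset.mul_sum, Complex.re_sum]
  refine Finset.sum_congr rfl fun i _ => Finset.sum_congr rfl fun j _ => ?_
  simp [Complex.mul_re]; ring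

lemma real_form_nonneg {n : ℕ} {P : Matrix (Fin n) (Fin n) ℂ} (hP : P.PosSemidef)
    (v : Fin n → ℝ) : 0 ≤ ∑ i, ∑ j, (P i j).re * v i * v j := by
  rw [← real_form]
  exact (Complex.le_def.mp (hP.dotProduct_mulVec_nonneg _)).1

lemma form_one_sub {n : ℕ} (A : Matrix (Fin n) (Fin n) ℂ) (v : Fin n → ℝ) :
    ∑ i, ∑ j, ((1 - A) i j).re * v i * v j
      = ∑ i, v i ^ 2 - ∑ i, ∑ j, (A i j).re * v i * v j := by
  rw [← Finset.sum_sub_distrib]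
  refine Finset.sum_congr rfl fun i _ => ?_
  have : v i ^ 2 = ∑ j, ((1 : Matrix (Fin n) (Fin n) ℂ) i j).re * v i * v j := by
    rw [Finset.sum_eq_single i]
    · simp [sq]
    · intro j _ hj; simp [Matrix.one_apply_ne hj.symm]
    · simp
  rw [this, ← Finset.sum_sub_distrib]
  refine Finset.sum_congr rfl fun j _ => ?_
  simp; ring

lemma sq_form {n : ℕ} (A : Matrix (Fin n) (Fin n) ℂ)
    (hA : A.PosSemidef) (hAI : ((1 : Matrix (Fin n) (Fin n) ℂ) - A).PosSemidef)
    (v : Fin n → ℝ) :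
    ∑ i, ‖∑ j, A i j * (v j : ℂ)‖ ^ 2 ≤ ∑ i, ∑ j, (A i j).re * v i * v j := by
  have hH : A.conjTranspose = A := hA.1
  have hP : (A - A.conjTranspose * A).PosSemidef := by
    have a := hAI.conjTranspose_mul_mul_same A
    have b := hA.conjTranspose_mul_mul_same (1 - A)
    have c := a.add b
    rw [Matrix.conjTranspose_sub, Matrix.conjTranspose_one, hH] at c
    rw [hH]
    convert c using 1
    noncomm_ring
  have h := real_form_nonneg hP v
  rw [← real_form, Matrix.sub_mulVec, dotProduct_sub, Complex.sub_re, real_form] at h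
  have e : dotProduct (star (fun i => (v i : ℂ)))
      ((A.conjTranspose * A).mulVec (fun i => (v i : ℂ)))
      = ((∑ i, ‖∑ j, A i j * (v j : ℂ)‖ ^ 2 : ℝ) : ℂ) := by
    rw [← Matrix.mulVec_mulVec, Matrix.dotProduct_mulVec, ← Matrix.star_mulVec]
    simp only [dotProduct, Pi.star_apply, Matrix.mulVec]
    push_cast
    refine Finset.sum_congr rfl fun i _ => ?_
    exact Complex.conj_mul' _
  rw [e, Complex.ofReal_re] at h
  linarith

/-- **Improved upper bound.** If `0 ⪯ A ⪯ I` is a Hermitian matrix with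
`tr(A) ≤ (1-ε)n`, then the permanent of `A` is a nonnegative real number
and `per(A) ≤ (1 - ε²/20)^n`. -/
theorem stmt_0 (n : ℕ) (hn : 1 ≤ n) (ε : ℝ) (hε : ε ∈ Set.Icc (0:ℝ) 1)
    (A : Matrix (Fin n) (Fin n) ℂ) (hHerm : A.IsHermitian)
    (hA : A.PosSemidef) (hAI : ((1 : Matrix (Fin n) (Fin n) ℂ) - A).PosSemidef)
    (htr : A.trace.re ≤ (1 - ε) * n) :
    (perm A).im = 0 ∧ 0 ≤ (perm A).re ∧ (perm A).re ≤ (1 - ε ^ 2 / 20) ^ n := by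
  have h0 := Complex.le_def.mp (perm_nonneg A hA)
  refine ⟨by simpa using h0.2.symm, by simpa using h0.1, ?_⟩
  refine (Complex.re_le_norm _).trans ?_
  -- exponential bound
  have hx : ∀ x : Fin n → Bool,
      ‖(∏ i, (sg (x i) : ℂ)) * ∏ i, ∑ j, A i j * (sg (x j) : ℂ)‖
      ≤ Real.exp (-(∑ i, ∑ j, ((1 - A) i j).re * sg (x i) * sg (x j)) / 2) := by
    intro x
    have hs : ∀ b, ‖(sg b : ℂ)‖ = 1 := by intro b; cases b <;> simp [sg]
    rw [norm_mul, norm_prod, norm_prod]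
    simp only [hs, Finset.prod_const_one, one_mul]
    have hb : ∀ y : ℝ, 0 ≤ y → y ≤ Real.exp ((y ^ 2 - 1) / 2) := by
      intro y _
      have := Real.add_one_le_exp ((y ^ 2 - 1) / 2)
      nlinarith [sq_nonneg (y - 1)]
    refine (Finset.prod_le_prod (fun i _ => norm_nonneg _)
      (fun i _ => hb _ (norm_nonneg _))).trans ?_
    rw [← Real.exp_sum]
    refine Real.exp_le_exp.mpr ?_
    rw [form_one_sub A (fun i => sg (x i)), ← Finset.sum_div, Finset.sum_sub_distrib]
    have e : ∑ i, sg (x i) ^ 2 = ∑ i : Fin n, (1:ℝ) :=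
      Finset.sum_congr rfl fun i _ => by rw [sq, sg_sq]
    have := sq_form A hA hAI (fun i => sg (x i))
    rw [e]
    linarith
  have hk := key n (fun i j => ((1 - A) i j).re)
    (fun i j => by
      have := hAI.1.apply i j
      rw [← this]; simp [-Matrix.sub_apply])
    (fun v => real_form_nonneg hAI v)
    (fun v => by
      rw [form_one_sub]
      have := real_form_nonneg hA v
      linarith)
  have hG : 2 ^ n * ‖perm A‖ ≤ 2 ^ n * Real.exp (-(∑ i, ((1 - A) i i).re) / 4) := by
    have : (2:ℝ) ^ n * ‖perm A‖ = ‖(2:ℂ) ^ n * perm A‖ := by simp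
    rw [this, ← glynn]
    exact (norm_sum_le _ _).trans ((Finset.sum_le_sum fun x _ => hx x).trans hk)
  have hG' := le_of_mul_le_mul_left hG (by positivity)
  refine hG'.trans ?_
  have ht : ∑ i, ((1 - A) i i).re = n - A.trace.re := by
    simp [Matrix.trace, Complex.re_sum]
  rw [ht]
  have h5 : Real.exp (-(n - A.trace.re) / 4) ≤ Real.exp (-ε / 4) ^ n := by
    rw [← Real.exp_nat_mul]
    refine Real.exp_le_exp.mpr ?_
    linarith
  refine h5.trans (pow_le_pow_left₀ (Real.exp_pos _).le ?_ n)
  obtain ⟨ha, hb⟩ := hε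
  have h6 := Real.add_one_le_exp (ε / 4)
  have h7 : Real.exp (-ε / 4) * Real.exp (ε / 4) = 1 := by
    rw [← Real.exp_add]; ring_nf; exact Real.exp_zero
  have h8 : 0 < Real.exp (-ε / 4) := Real.exp_pos _
  have h9 : Real.exp (-ε / 4) * (ε / 4 + 1) ≤ 1 := by nlinarith
  have h10 : 1 ≤ (1 - ε ^ 2 / 20) * (ε / 4 + 1) := by
    nlinarith [mul_nonneg ha (sub_nonneg.mpr hb), mul_nonneg (mul_nonneg ha ha) (sub_nonneg.mpr hb)]
  exact le_of_mul_le_mul_right (h9.trans h10) (by linarith)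
end

section
/- For every x ≥ 0, Σ_{k=3}^∞ (−x)^k/(k·k!) ≤ 0. Consequently, for every x > 0, the exponential integral satisfies Ei(−x) = −∫_x^∞ (e^{−t}/t) dt ≤ γ + ln(x) − x + x²/4. -/
open scoped BigOperators
open MeasureTheory Real

theorem exp_neg_le_quadratic {y : ℝ} (hy : 0 ≤ y) : Real.exp (-y) ≤ 1 - y + y ^ 2 / 2 := by
  have h := Real.quadratic_le_exp_of_nonneg hy
  have hpos : 0 < 1 - y + y ^ 2 / 2 := by nlinarith [sq_nonneg (y - 1)]
  rw [Real.exp_neg]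
  rw [inv_le_iff_one_le_mul₀ (Real.exp_pos y)]
  calc (1 : ℝ) ≤ (1 - y + y ^ 2 / 2) * (1 + y + y ^ 2 / 2) := by nlinarith [sq_nonneg (y ^ 2)]
    _ ≤ _ := by gcongr

theorem hasSum_tail (y : ℝ) : HasSum (fun k : ℕ => y ^ (k + 3) / ((k + 3).factorial : ℝ))
    (Real.exp y - (1 + y + y ^ 2 / 2)) := by
  have h := NormedSpace.expSeries_div_hasSum_exp (𝔸 := ℝ) y
  rw [← Real.exp_eq_exp_ℝ] at h
  have h2 := (hasSum_nat_add_iff' 3).2 h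
  simpa [Finset.sum_range_succ, Nat.factorial] using h2

theorem tsum_part (x : ℝ) (hx : 0 ≤ x) :
    (∑' k : ℕ, (-x) ^ (k + 3) / (((k + 3) * Nat.factorial (k + 3) : ℕ) : ℝ)) ≤ 0 := by
  let f : ℕ → C(ℝ, ℝ) := fun k =>
    ⟨fun u => (-x) ^ (k + 3) / ((k + 3).factorial : ℝ) * u ^ (k + 2), by fun_prop⟩
  have hf : ∀ k u, f k u = (-x) ^ (k + 3) / ((k + 3).factorial : ℝ) * u ^ (k + 2) :=
    fun _ _ => rfl
  have hterm : ∀ k : ℕ, (-x) ^ (k + 3) / (((k + 3) * Nat.factorial (k + 3) : ℕ) : ℝ)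
      = ∫ u in (0:ℝ)..1, f k u := by
    intro k
    simp only [hf]
    rw [intervalIntegral.integral_const_mul, integral_pow]
    have : ((k + 3).factorial : ℝ) ≠ 0 := by positivity
    push_cast
    have h3 : (k : ℝ) + 2 + 1 = k + 3 := by ring
    rw [h3]
    have : (k : ℝ) + 3 ≠ 0 := by positivity
    simp
    field_simp
  simp_rw [hterm]
  rw [intervalIntegral.tsum_intervalIntegral_eq_of_summable_norm]
  · rw [← neg_nonneg, ← intervalIntegral.integral_neg]
    apply intervalIntegral.integral_nonneg zero_le_one
    intro u hu
    rw [neg_nonneg]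
    rcases hu.1.eq_or_lt with h0 | hpos
    · subst h0
      simp [hf]
    · have hs := (hasSum_tail (-(x * u))).div_const u
      have he : (fun k => f k u) =
          fun k : ℕ => (-(x * u)) ^ (k + 3) / ((k + 3).factorial : ℝ) / u := by
        ext k
        rw [hf, show -(x * u) = (-x) * u by ring, mul_pow]
        field_simp
        ring
      rw [he, hs.tsum_eq]
      apply div_nonpos_of_nonpos_of_nonneg _ hpos.le
      have := exp_neg_le_quadratic (mul_nonneg hx hpos.le)
      linarith [neg_sq (x * u)]
  · refine Summable.of_nonneg_of_le (fun _ => norm_nonneg _) (fun k => ?_) (hasSum_tail x).summable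
    rw [ContinuousMap.norm_le _ (by positivity)]
    rintro ⟨u, hu⟩
    have hu' : u ∈ Set.Icc (0:ℝ) 1 := by simpa using hu
    simp only [ContinuousMap.restrict_apply, hf, norm_mul, norm_div, norm_pow, norm_neg]
    rw [Real.norm_of_nonneg hx, Real.norm_of_nonneg hu'.1]
    simp only [RCLike.norm_natCast]
    exact mul_le_of_le_one_right (by positivity) (pow_le_one₀ hu'.1 hu'.2)

theorem integral_log_exp :
    ∫ t in Set.Ioi (0:ℝ), Real.log t * Real.exp (-t) = -Real.eulerMascheroniConstant := by
  have h1 := Complex.hasDerivAt_GammaIntegral (s := 1) (by simp)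
  have h2 := Complex.hasDerivAt_Gamma_one
  have h3 : Complex.GammaIntegral =ᶠ[nhds 1] Complex.Gamma := by
    have : IsOpen {s : ℂ | 0 < s.re} := isOpen_lt continuous_const Complex.continuous_re
    filter_upwards [this.mem_nhds (by simp : (1:ℂ) ∈ {s : ℂ | 0 < s.re})] with a ha
    exact (Complex.Gamma_eq_integral ha).symm
  have h4 := h1.unique (h2.congr_of_eventuallyEq h3)
  simp only [sub_self, Complex.cpow_zero, one_mul] at h4
  have h5 : (∫ t in Set.Ioi (0:ℝ), ((Real.log t : ℂ) * (Real.exp (-t) : ℂ)))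
      = ((∫ t in Set.Ioi (0:ℝ), Real.log t * Real.exp (-t) : ℝ) : ℂ) := by
    rw [← integral_complex_ofReal]
    simp
  rw [h5] at h4
  exact_mod_cast h4

theorem integrable_log_exp :
    IntegrableOn (fun t => Real.log t * Real.exp (-t)) (Set.Ioi 0) := by
  apply Integrable.of_integral_ne_zero
  rw [integral_log_exp]
  have := Real.one_half_lt_eulerMascheroniConstant
  linarith

theorem ii_log_exp (a b : ℝ) :
    IntervalIntegrable (fun t => Real.log t * Real.exp (-t)) volume a b :=
  intervalIntegral.intervalIntegrable_log'.mul_continuousOn (by fun_prop)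

theorem K_nonpos (x : ℝ) (hx : 0 ≤ x) :
    (∫ t in (0:ℝ)..x, Real.log t * Real.exp (-t)) + (Real.exp (-x) - 1) * Real.log x
      + x - x ^ 2 / 4 ≤ 0 := by
  let K : ℝ → ℝ := fun x => (∫ t in (0:ℝ)..x, Real.log t * Real.exp (-t))
    + (Real.exp (-x) - 1) * Real.log x + x - x ^ 2 / 4
  have hd : ∀ y ∈ Set.Ioi (0:ℝ), HasDerivAt K
      (Real.log y * Real.exp (-y) + ((-Real.exp (-y)) * Real.log y
        + (Real.exp (-y) - 1) * y⁻¹) + 1 - (2 * y) / 4) y := by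
    intro y hy
    have hy : 0 < y := hy
    have hI : HasDerivAt (fun x => ∫ t in (0:ℝ)..x, Real.log t * Real.exp (-t))
        (Real.log y * Real.exp (-y)) y := by
      apply intervalIntegral.integral_hasDerivAt_right (ii_log_exp 0 y)
      · exact StronglyMeasurable.stronglyMeasurableAtFilter
          (Measurable.stronglyMeasurable (by fun_prop))
      · exact (Real.continuousAt_log hy.ne').mul (by fun_prop)
    have he : HasDerivAt (fun x => Real.exp (-x) - 1) (-Real.exp (-y)) y := by
      simpa using ((hasDerivAt_neg y).exp).sub_const 1
    have hq : HasDerivAt (fun x : ℝ => x ^ 2 / 4) (2 * y / 4) y := by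
      simpa using (hasDerivAt_pow 2 y).div_const 4
    exact ((hI.add (he.mul (Real.hasDerivAt_log hy.ne'))).add (hasDerivAt_id y)).sub hq
  have hc : ContinuousOn K (Set.Ici 0) := by
    have hm : ContinuousOn (fun x => (Real.exp (-x) - 1) * Real.log x) (Set.Ici 0) := by
      intro y hy
      rcases (show (0:ℝ) ≤ y from hy).eq_or_lt with h0 | hpos
      · subst h0
        show Filter.Tendsto _ _ _
        simp only [Real.log_zero, mul_zero]
        have ht : Filter.Tendsto (fun x : ℝ => |x * Real.log x|) (nhdsWithin 0 (Set.Ici 0))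
            (nhds 0) := by
          have := (Real.continuous_mul_log.abs.tendsto 0).mono_left
            (nhdsWithin_le_nhds (s := Set.Ici 0))
          simpa using this
        refine squeeze_zero_norm' ?_ ht
        filter_upwards [self_mem_nhdsWithin] with z hz
        have hz : (0:ℝ) ≤ z := hz
        rw [Real.norm_eq_abs, abs_mul, abs_mul]
        apply mul_le_mul_of_nonneg_right _ (abs_nonneg _)
        rw [abs_of_nonneg hz, abs_le]
        have h1 := Real.add_one_le_exp (-z)
        have h2 := Real.exp_le_one_iff.2 (neg_nonpos.2 hz)
        constructor <;> linarith
      · exact (ContinuousAt.mul (by fun_prop)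
          (Real.continuousAt_log hpos.ne')).continuousWithinAt
    have hI : Continuous (fun x => ∫ t in (0:ℝ)..x, Real.log t * Real.exp (-t)) :=
      intervalIntegral.continuous_primitive ii_log_exp 0
    exact ((hI.continuousOn.add hm).add continuousOn_id).sub (by fun_prop)
  have hanti : AntitoneOn K (Set.Ici 0) := by
    apply antitoneOn_of_deriv_nonpos (convex_Ici 0) hc
    · intro y hy
      rw [interior_Ici] at hy
      exact (hd y hy).differentiableAt.differentiableWithinAt
    · intro y hy
      rw [interior_Ici] at hy
      rw [(hd y hy).deriv]
      have hy : 0 < y := hy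
      have h := exp_neg_le_quadratic hy.le
      have : Real.log y * Real.exp (-y) + ((-Real.exp (-y)) * Real.log y
        + (Real.exp (-y) - 1) * y⁻¹) + 1 - (2 * y) / 4
        = (Real.exp (-y) - (1 - y + y ^ 2 / 2)) / y := by
        field_simp
        ring
      rw [this]
      exact div_nonpos_of_nonpos_of_nonneg (by linarith) hy.le
  have := hanti (Set.self_mem_Ici) hx hx
  simpa [K] using this

theorem E1_eq (x : ℝ) (hx : 0 < x) :
    ∫ t in Set.Ioi x, Real.exp (-t) / t = - Real.exp (-x) * Real.log x
      - Real.eulerMascheroniConstant - ∫ t in (0:ℝ)..x, Real.log t * Real.exp (-t) := by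
  have hL : IntegrableOn (fun t => Real.log t * Real.exp (-t)) (Set.Ioi x) :=
    integrable_log_exp.mono_set (Set.Ioi_subset_Ioi hx.le)
  have hE : IntegrableOn (fun t => Real.exp (-t) / t) (Set.Ioi x) := by
    have h0 : IntegrableOn (fun t => Real.exp (-t) * x⁻¹) (Set.Ioi x) :=
      (integrableOn_exp_neg_Ioi x).mul_const _
    refine Integrable.mono' h0 (Measurable.aestronglyMeasurable (by fun_prop)) ?_
    refine (ae_restrict_iff' measurableSet_Ioi).2 (Filter.Eventually.of_forall fun t ht => ?_)
    have ht : x < t := ht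
    have : 0 < t := hx.trans ht
    rw [Real.norm_of_nonneg (by positivity), div_eq_mul_inv]
    gcongr
  have hsplit : (∫ t in (0:ℝ)..x, Real.log t * Real.exp (-t))
      + ∫ t in Set.Ioi x, Real.log t * Real.exp (-t) = -Real.eulerMascheroniConstant := by
    rw [← integral_log_exp]
    exact intervalIntegral.integral_interval_add_Ioi integrable_log_exp hL
  have htend : Filter.Tendsto (fun t => Real.log t * Real.exp (-t)) Filter.atTop (nhds 0) := by
    have h1 : Filter.Tendsto (fun t : ℝ => t ^ 1 * Real.exp (-t)) Filter.atTop (nhds 0) :=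
      Real.tendsto_pow_mul_exp_neg_atTop_nhds_zero 1
    refine squeeze_zero' ?_ ?_ h1
    · filter_upwards [Filter.eventually_ge_atTop 1] with t ht
      exact mul_nonneg (Real.log_nonneg ht) (Real.exp_pos _).le
    · filter_upwards [Filter.eventually_ge_atTop 1] with t ht
      apply mul_le_mul_of_nonneg_right _ (Real.exp_pos _).le
      have := Real.log_le_sub_one_of_pos (show 0 < t by linarith)
      linarith
  have hparts := integral_Ioi_of_hasDerivAt_of_tendsto' (a := x)
    (f := fun t => Real.log t * Real.exp (-t))
    (f' := fun t => Real.exp (-t) / t - Real.log t * Real.exp (-t)) (m := 0)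
    (by
      intro t ht
      have ht : 0 < t := hx.trans_le ht
      have := (Real.hasDerivAt_log ht.ne').mul ((hasDerivAt_neg t).exp)
      refine this.congr_deriv ?_
      field_simp
      ring)
    (hE.sub hL) htend
  rw [integral_sub hE hL] at hparts
  linarith

/-- For `x ≥ 0`, `Σ_{k=3}^∞ (−x)^k/(k·k!) ≤ 0`; consequently for `x > 0` the
exponential integral satisfies `Ei(−x) = −∫_x^∞ e^{−t}/t dt ≤ γ + ln x − x + x²/4`. -/
theorem stmt_4 (x : ℝ) (hx : 0 ≤ x) :
    (∑' k : ℕ, (-x) ^ (k + 3) / (((k + 3) * Nat.factorial (k + 3) : ℕ) : ℝ)) ≤ 0 ∧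
      (0 < x →
        -(∫ t in Set.Ioi x, Real.exp (-t) / t) ≤
          Real.eulerMascheroniConstant + Real.log x - x + x ^ 2 / 4) := by
  refine ⟨tsum_part x hx, fun hpos => ?_⟩
  rw [E1_eq x hpos]
  have := K_nonpos x hx
  linarith
end

section
/- Let A, B ∈ ℂ^{n×n} be Hermitian matrices with A ⪰ B ⪰ 0. Then per(A) and per(B) are nonnegative real numbers and per(A) ≥ per(B). -/
open scoped BigOperators ComplexOrder

lemma had_psd {κ : Type*} (A B : Matrix κ κ ℂ)
    (hA : A.PosSemidef) (hB : B.PosSemidef) : (Matrix.hadamard A B).PosSemidef :=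
  Matrix.PosSemidef.hadamard hA hB

lemma prod_psd {ι κ : Type*} [Fintype κ] [DecidableEq κ] (s : Finset ι)
    (A B : ι → Matrix κ κ ℂ)
    (hB : ∀ i, (B i).PosSemidef) (hAB : ∀ i, (A i - B i).PosSemidef) :
    (Matrix.of fun a b => ∏ i ∈ s, B i a b).PosSemidef ∧
    ((Matrix.of fun a b => ∏ i ∈ s, A i a b) -
      Matrix.of fun a b => ∏ i ∈ s, B i a b).PosSemidef := by
  classical
  induction s using Finset.induction_on with
  | empty =>
    constructor
    · have h := Matrix.posSemidef_vecMulVec_self_star (R := ℂ) (fun _ : κ => (1 : ℂ))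
      convert h using 1
      ext a b
      simp [Matrix.vecMulVec]
    · simpa using (Matrix.PosSemidef.zero : (0 : Matrix κ κ ℂ).PosSemidef)
  | insert j s hj ih =>
    obtain ⟨h1, h2⟩ := ih
    constructor
    · convert had_psd _ _ (hB j) h1 using 1
      ext a b
      simp [Finset.prod_insert hj]
    · have hA : (A j).PosSemidef := by simpa using (hAB j).add (hB j)
      convert (had_psd _ _ hA h2).add (had_psd _ _ (hAB j) h1) using 1
      ext a b
      simp [Finset.prod_insert hj]
      ring

lemma sum_psd {κ : Type*} [Fintype κ] (M : Matrix κ κ ℂ) (h : M.PosSemidef) :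
    0 ≤ ∑ a, ∑ b, M a b := by
  have := h.dotProduct_mulVec_nonneg (fun _ => (1 : ℂ))
  simpa [dotProduct, Matrix.mulVec] using this

lemma sum_perm {n : ℕ} (A : Matrix (Fin n) (Fin n) ℂ) :
    ∑ a : Equiv.Perm (Fin n), ∑ b : Equiv.Perm (Fin n), ∏ i, A (a i) (b i)
      = (n.factorial : ℂ) * perm A := by
  have : ∀ a : Equiv.Perm (Fin n),
      ∑ b : Equiv.Perm (Fin n), ∏ i, A (a i) (b i) = perm A := by
    intro a
    unfold perm
    rw [← Equiv.sum_comp (Equiv.mulRight a)]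
    refine Finset.sum_congr rfl fun b _ => ?_
    simpa using Equiv.prod_comp a (fun i => A i (b i))
  simp [this, Fintype.card_perm]

/-- **Monotonicity of the permanent on PSD matrices.** If `A ⪰ B ⪰ 0` are Hermitian
matrices, then `per(A)` and `per(B)` are nonnegative real numbers and
`per(A) ≥ per(B)`. -/
theorem stmt_6 (n : ℕ) (A B : Matrix (Fin n) (Fin n) ℂ)
    (hAHerm : A.IsHermitian) (hBHerm : B.IsHermitian)
    (hB : B.PosSemidef) (hAB : (A - B).PosSemidef) :
    (perm A).im = 0 ∧ (perm B).im = 0 ∧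
      0 ≤ (perm B).re ∧ 0 ≤ (perm A).re ∧ (perm B).re ≤ (perm A).re := by
  obtain ⟨h1, h2⟩ := prod_psd (κ := Equiv.Perm (Fin n)) (Finset.univ : Finset (Fin n))
    (fun i => A.submatrix (fun σ => σ i) (fun σ => σ i))
    (fun i => B.submatrix (fun σ => σ i) (fun σ => σ i))
    (fun i => hB.submatrix _) (fun i => hAB.submatrix _)
  have k1 := sum_psd _ h1
  have k2 := sum_psd _ h2
  simp only [Matrix.sub_apply, Matrix.of_apply, Matrix.submatrix_apply,
    Finset.sum_sub_distrib, sum_perm] at k1 k2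
  have hn : (0 : ℝ) < n.factorial := by exact_mod_cast n.factorial_pos
  rw [← mul_sub] at k2
  rw [Complex.le_def] at k1 k2
  simp only [Complex.mul_re, Complex.mul_im, Complex.natCast_re, Complex.natCast_im,
    Complex.zero_re, Complex.zero_im, Complex.sub_re, Complex.sub_im, zero_mul, sub_zero,
    add_zero] at k1 k2
  have b1 := nonneg_of_mul_nonneg_right k1.1 hn
  have b2 := nonneg_of_mul_nonneg_right k2.1 hn
  have b3 := (mul_eq_zero.mp k1.2.symm).resolve_left hn.ne'
  have b4 := (mul_eq_zero.mp k2.2.symm).resolve_left hn.ne'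
  refine ⟨?_, b3, ?_, ?_, ?_⟩ <;> linarith
end

section
/- Let V ∈ ℝ^{n×d} have rows v_1,…,v_n. Then E_{x ~ N(0, I_d)}[ ∏_{i=1}^n ⟨v_i, x⟩² ] = c_{n,d}^ℝ · E_{x}[ ∏_{i=1}^n ⟨v_i, x⟩² ], where in the last expectation x is uniformly distributed on the sphere {x ∈ ℝ^d : ‖x‖_{ℓ2} = √d}, and c_{n,d}^ℝ = Γ(n + d/2) / (Γ(d/2) · (d/2)^n). -/
open scoped BigOperators
open Matrix MeasureTheory

theorem aux_polar {E : Type*} [NormedAddCommGroup E] [NormedSpace ℝ E] [MeasurableSpace E]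
    [Nontrivial E] (μ : Measure E) [FiniteDimensional ℝ E] [BorelSpace E] [μ.IsAddHaarMeasure]
    (f : ℝ → ℝ) (g : E → ℝ) :
    ∫ x, f ‖x‖ * g (‖x‖⁻¹ • x) ∂μ = (∫ u, g (u : E) ∂μ.toSphere) *
      ∫ y in Set.Ioi (0 : ℝ), y ^ (Module.finrank ℝ E - 1) * f y :=
  calc
    ∫ x, f ‖x‖ * g (‖x‖⁻¹ • x) ∂μ
      = ∫ x : ({(0)}ᶜ : Set E), f ‖x.1‖ * g (‖x.1‖⁻¹ • x.1) ∂(μ.comap (↑)) := by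
      rw [integral_subtype_comap (measurableSet_singleton _).compl
        fun x ↦ f ‖x‖ * g (‖x‖⁻¹ • x), restrict_compl_singleton]
    _ = ∫ x, g x.1 * f x.2 ∂μ.toSphere.prod (.volumeIoiPow (Module.finrank ℝ E - 1)) := by
      simpa [mul_comm] using μ.measurePreserving_homeomorphUnitSphereProd.integral_comp
        (Homeomorph.measurableEmbedding _) (fun p => g p.1 * f p.2)
    _ = (∫ u, g (u : E) ∂μ.toSphere) *
          ∫ x : Set.Ioi (0 : ℝ), f x ∂.volumeIoiPow (Module.finrank ℝ E - 1) :=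
      integral_prod_mul (fun u : Metric.sphere (0 : E) 1 => g u)
        (fun r : Set.Ioi (0 : ℝ) => f r)
    _ = _ := by
      congr 1
      simp only [Measure.volumeIoiPow, ENNReal.ofReal]
      rw [integral_withDensity_eq_integral_smul,
        integral_subtype_comap measurableSet_Ioi
          fun a ↦ Real.toNNReal (a ^ (Module.finrank ℝ E - 1)) • f a,
        setIntegral_congr_fun measurableSet_Ioi fun x hx ↦ ?_]
      · rw [NNReal.smul_def, Real.coe_toNNReal _ (pow_nonneg hx.out.le _), smul_eq_mul]
      · exact (measurable_subtype_coe.pow_const _).real_toNNReal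

theorem aux_radial (n d : ℕ) (hd : 1 ≤ d) :
    ∫ y in Set.Ioi (0 : ℝ), y ^ (d - 1) * (Real.exp (-y ^ 2 / 2) * y ^ (2 * n)) =
      2 ^ n * 2 ^ ((d : ℝ) / 2) / 2 * Real.Gamma ((n : ℝ) + (d : ℝ) / 2) := by
  have h := integral_rpow_mul_exp_neg_mul_rpow (p := 2) (q := (d : ℝ) - 1 + 2 * n) (b := 1 / 2)
    (by norm_num) (by
      have : (1 : ℝ) ≤ d := by exact_mod_cast hd
      have : (0 : ℝ) ≤ n := by positivity
      linarith) (by norm_num)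
  have e : ((d : ℝ) - 1 + 2 * n + 1) / 2 = n + d / 2 := by ring
  have e2 : -((d : ℝ) - 1 + 2 * n + 1) / 2 = -(n + d / 2) := by ring
  rw [e2, e] at h
  rw [show (1 / 2 : ℝ) ^ (-((n : ℝ) + d / 2)) = 2 ^ n * 2 ^ ((d : ℝ) / 2) by
    rw [one_div, Real.inv_rpow (by norm_num), ← Real.rpow_neg (by norm_num), neg_neg,
      Real.rpow_add (by norm_num), Real.rpow_natCast]] at h
  rw [div_eq_mul_one_div _ (2 : ℝ), ← h]
  refine setIntegral_congr_fun measurableSet_Ioi fun x hx ↦ ?_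
  have e3 : (d : ℝ) - 1 + 2 * n = ((d - 1 + 2 * n : ℕ) : ℝ) := by
    push_cast [Nat.cast_sub hd]; ring
  beta_reduce
  rw [e3, Real.rpow_natCast, Real.rpow_two, pow_add,
    show -x ^ 2 / 2 = -(1 / 2) * x ^ 2 by ring]
  ring

theorem aux_hom (n d : ℕ) (V : Matrix (Fin n) (Fin d) ℝ) (c : ℝ) (x : Fin d → ℝ) :
    ∏ i, (V i ⬝ᵥ (fun j => c * x j)) ^ 2 = c ^ (2 * n) * ∏ i, (V i ⬝ᵥ x) ^ 2 := by
  have : ∀ i, V i ⬝ᵥ (fun j => c * x j) = c * (V i ⬝ᵥ x) := fun i => by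
    rw [← smul_eq_mul, ← dotProduct_smul]; rfl
  simp only [this, mul_pow, Finset.prod_mul_distrib]
  simp [pow_mul]

/-- **Gaussian vs. spherical averages (real case).** For `V ∈ ℝ^{n×d}` with rows `vᵢ`,
`E_{x∼N(0,I_d)}[∏ᵢ ⟨vᵢ,x⟩²] = c_{n,d}^ℝ · E_{x∼unif sphere}[∏ᵢ ⟨vᵢ,x⟩²]`, where the
uniform distribution on the sphere `{‖x‖_{ℓ2} = √d}` is realized as the pushforward of
the standard Gaussian under the radial normalization `x ↦ (√d/‖x‖)·x`, and
`c_{n,d}^ℝ = Γ(n+d/2)/(Γ(d/2)·(d/2)ⁿ)`. -/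
theorem stmt_8 (n d : ℕ) (hd : 1 ≤ d) (V : Matrix (Fin n) (Fin d) ℝ) :
    (∫ x : Fin d → ℝ, (2 * Real.pi) ^ (-(d : ℝ) / 2) * Real.exp (-(∑ j, x j ^ 2) / 2) *
        ∏ i, (V i ⬝ᵥ x) ^ 2) =
      Real.Gamma ((n : ℝ) + (d : ℝ) / 2) / (Real.Gamma ((d : ℝ) / 2) * ((d : ℝ) / 2) ^ n) *
        ∫ x : Fin d → ℝ, (2 * Real.pi) ^ (-(d : ℝ) / 2) * Real.exp (-(∑ j, x j ^ 2) / 2) *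
          ∏ i, (V i ⬝ᵥ (fun j => Real.sqrt d / Real.sqrt (∑ l, x l ^ 2) * x j)) ^ 2 := by
  have : NeZero d := ⟨by omega⟩
  have : Nonempty (Fin d) := ⟨0⟩
  let E := EuclideanSpace ℝ (Fin d)
  have hdim : Module.finrank ℝ E = d := by simp [E]
  let G : E → ℝ := fun x => ∏ i, (V i ⬝ᵥ (fun j => x j)) ^ 2
  let C : ℝ := (2 * Real.pi) ^ (-(d : ℝ) / 2)
  have hT : ∀ F : (Fin d → ℝ) → ℝ, ∫ x, F x = ∫ x : E, F (fun j => x j) := fun F =>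
    ((EuclideanSpace.volume_preserving_symm_measurableEquiv_toLp (Fin d)).integral_comp
      (MeasurableEquiv.measurableEmbedding _) F).symm
  have hG : ∀ (c : ℝ) (x : E), G (c • x) = c ^ (2 * n) * G x := fun c x =>
    aux_hom n d V c (fun j => x j)
  have hN : ∀ x : E, Real.sqrt (∑ j, x j ^ 2) = ‖x‖ := fun x => by
    rw [EuclideanSpace.norm_eq (𝕜 := ℝ) (n := Fin d) x]; simp
  have hN2 : ∀ x : E, ∑ j, x j ^ 2 = ‖x‖ ^ 2 := fun x => by
    rw [← hN, Real.sq_sqrt (by positivity)]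
  have h1 := aux_polar (volume : Measure E)
    (fun r => C * (Real.exp (-r ^ 2 / 2) * r ^ (2 * n))) G
  have h2 := aux_polar (volume : Measure E)
    (fun r => C * d ^ n * (Real.exp (-r ^ 2 / 2) * r ^ (2 * 0))) G
  simp only [mul_left_comm _ C, mul_left_comm _ (C * (d : ℝ) ^ n), integral_const_mul, hdim,
    aux_radial n d hd, aux_radial 0 d hd] at h1 h2
  rw [hT, hT]
  have hL : (∫ x : E, (2 * Real.pi) ^ (-(d : ℝ) / 2) * Real.exp (-(∑ j, x j ^ 2) / 2) *
        ∏ i, (V i ⬝ᵥ (fun j => x j)) ^ 2) =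
      ∫ x : E, C * (Real.exp (-‖x‖ ^ 2 / 2) * ‖x‖ ^ (2 * n)) * G (‖x‖⁻¹ • x) := by
    congr 1
    funext x
    rw [hN2, hG]
    change C * _ * G x = _
    by_cases hx : x = 0
    · rcases Nat.eq_zero_or_pos n with h | h
      · subst h; simp
      · have : G x = 0 := by
          have := hG 0 x
          rw [hx] at this ⊢
          simpa [h.ne'] using this
        rw [this]; simp
    · have : ‖x‖ ≠ 0 := norm_ne_zero_iff.2 hx
      have : ‖x‖ ^ (2 * n) * ‖x‖⁻¹ ^ (2 * n) = 1 := by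
        rw [← mul_pow, mul_inv_cancel₀ this, one_pow]
      linear_combination (-C * Real.exp (-‖x‖ ^ 2 / 2) * G x) * this
  have hR : (∫ x : E, (2 * Real.pi) ^ (-(d : ℝ) / 2) * Real.exp (-(∑ j, x j ^ 2) / 2) *
        ∏ i, (V i ⬝ᵥ (fun j => Real.sqrt d / Real.sqrt (∑ l, x l ^ 2) * x j)) ^ 2) =
      ∫ x : E, C * d ^ n * (Real.exp (-‖x‖ ^ 2 / 2) * ‖x‖ ^ (2 * 0)) * G (‖x‖⁻¹ • x) := by
    congr 1
    funext x
    rw [hN, hN2, hG, aux_hom, div_eq_mul_inv (√(d : ℝ)), mul_pow, pow_mul √(d : ℝ),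
      Real.sq_sqrt (by positivity)]
    change C * _ * (_ * G x) = _
    ring
  rw [hL, hR]
  rw [h1, h2]
  have hd0 : (d : ℝ) ≠ 0 := by exact_mod_cast (by omega : d ≠ 0)
  have hg : Real.Gamma ((d : ℝ) / 2) ≠ 0 := (Real.Gamma_pos_of_pos (by positivity)).ne'
  simp only [Nat.cast_zero, zero_add, pow_zero, div_pow]
  field_simp
end

section
/- Let V ∈ ℂ^{n×n} have rows v_1,…,v_n. Suppose X* is a positive semidefinite matrix with tr(X*) = n that maximizes X ↦ ∏_{i=1}^n v_i† X v_i over all positive semidefinite X with tr(X) = n, and suppose v_i† X* v_i = 1 for all i ∈ [n]. Then VV† ⪯ I (equivalently, V†V ⪯ I). -/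
open scoped BigOperators ComplexOrder
open Matrix

lemma prod_expand {ι : Type*} (s : Finset ι) (a : ι → ℝ) :
    ∃ q : ℝ → ℝ, Continuous q ∧ ∀ t, ∏ i ∈ s, (1 + t * a i) = 1 + t * ∑ i ∈ s, a i + t ^ 2 * q t := by
  classical
  induction s using Finset.induction_on with
  | empty => exact ⟨fun _ => 0, continuous_const, by simp⟩
  | insert j s hj ih =>
    obtain ⟨q, hq, h⟩ := ih
    refine ⟨fun t => (∑ i ∈ s, a i) * a j + q t + t * a j * q t, by fun_prop, fun t => ?_⟩
    rw [Finset.prod_insert hj, Finset.sum_insert hj, h]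
    ring

lemma sum_nonpos_of_prod_le {ι : Type*} (s : Finset ι) (a : ι → ℝ)
    (h : ∀ t, 0 < t → t < 1 → ∏ i ∈ s, (1 + t * a i) ≤ 1) : ∑ i ∈ s, a i ≤ 0 := by
  obtain ⟨q, hq, hp⟩ := prod_expand s a
  have hc : Filter.Tendsto (fun t => -(t * q t)) (nhdsWithin 0 (Set.Ioi 0)) (nhds 0) := by
    have : Continuous (fun t => -(t * q t)) := by fun_prop
    have h2 := this.tendsto 0
    simp only [zero_mul, neg_zero] at h2
    exact h2.mono_left nhdsWithin_le_nhds
  refine ge_of_tendsto hc ?_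
  filter_upwards [Ioo_mem_nhdsGT (zero_lt_one (α := ℝ))] with t ht
  have h1 := h t ht.1 ht.2
  rw [hp] at h1
  have : t * (∑ i ∈ s, a i + t * q t) ≤ t * 0 := by nlinarith
  have := le_of_mul_le_mul_left this ht.1
  linarith

/-- If `X*` is a PSD maximizer of `X ↦ ∏ i, vᵢ† X vᵢ` over PSD matrices of trace `n`,
normalized so that `vᵢ† X* vᵢ = 1` for all `i`, then `V Vᴴ ⪯ I`
(equivalently `Vᴴ V ⪯ I`). -/
theorem stmt_9 (n : ℕ) (V Xs : Matrix (Fin n) (Fin n) ℂ)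
    (hXs : Xs.PosSemidef) (htrXs : Xs.trace = (n : ℂ))
    (hmax : ∀ X : Matrix (Fin n) (Fin n) ℂ, X.PosSemidef → X.trace = (n : ℂ) →
      (∏ i, (star (V i) ⬝ᵥ (X *ᵥ V i)).re) ≤ ∏ i, (star (V i) ⬝ᵥ (Xs *ᵥ V i)).re)
    (hnorm : ∀ i, star (V i) ⬝ᵥ (Xs *ᵥ V i) = 1) :
    ((1 : Matrix (Fin n) (Fin n) ℂ) - V * Vᴴ).PosSemidef ∧
      ((1 : Matrix (Fin n) (Fin n) ℂ) - Vᴴ * V).PosSemidef := by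
  have hsq : ∀ z : Fin n → ℂ, star z ⬝ᵥ z = ((∑ i, Complex.normSq (z i) : ℝ) : ℂ) := by
    intro z
    simp [dotProduct, Complex.normSq_eq_conj_mul_self]
  have key : ((1 : Matrix (Fin n) (Fin n) ℂ) - Vᴴ * V).PosSemidef := by
    refine PosSemidef.of_dotProduct_mulVec_nonneg
      (isHermitian_one.sub (isHermitian_conjTranspose_mul_self V)) fun x => ?_
    have e : star x ⬝ᵥ ((1 - Vᴴ * V) *ᵥ x) = star x ⬝ᵥ x - star (V *ᵥ x) ⬝ᵥ (V *ᵥ x) := by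
      rw [sub_mulVec, one_mulVec, dotProduct_sub, ← mulVec_mulVec, star_mulVec,
        ← dotProduct_mulVec]
    rw [e, hsq, hsq, ← Complex.ofReal_sub, Complex.zero_le_real, sub_nonneg]
    by_cases hx : x = 0
    · simp [hx]
    set r : ℝ := ∑ i, Complex.normSq (x i) with hr
    have hrpos : 0 < r := by
      obtain ⟨i, hi⟩ := Function.ne_iff.mp hx
      exact Finset.sum_pos' (fun i _ => Complex.normSq_nonneg _)
        ⟨i, Finset.mem_univ _, Complex.normSq_pos.mpr hi⟩
    have hn : (0 : ℝ) < n := by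
      obtain ⟨i, hi⟩ := Function.ne_iff.mp hx
      exact_mod_cast i.pos
    have hS := sum_nonpos_of_prod_le Finset.univ
      (fun i => n / r * Complex.normSq ((V *ᵥ x) i) - 1) (by
      intro t ht0 ht1
      have h := hmax (((1 - t : ℝ) : ℂ) • Xs +
          ((t * (n / r) : ℝ) : ℂ) • vecMulVec (star x) (star (star x))) ?_ ?_
      · simp only [hnorm, Complex.one_re, Finset.prod_const_one] at h
        refine le_of_eq_of_le (Finset.prod_congr rfl fun i _ => ?_) h
        have h1 : star (V i) ⬝ᵥ (vecMulVec (star x) (star (star x)) *ᵥ V i) =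
            (Complex.normSq ((V *ᵥ x) i) : ℂ) := by
          rw [vecMulVec_mulVec, Complex.normSq_eq_conj_mul_self]
          have h4 : (V *ᵥ x) i = x ⬝ᵥ V i := dotProduct_comm _ _
          rw [star_star, dotProduct_smul, star_dotProduct_star, h4]
          rfl
        rw [add_mulVec, smul_mulVec, smul_mulVec, dotProduct_add, dotProduct_smul,
          dotProduct_smul, hnorm, h1, smul_eq_mul, smul_eq_mul, mul_one, ← Complex.ofReal_mul,
          ← Complex.ofReal_add, Complex.ofReal_re]
        ring
      · refine (hXs.smul ?_).add ((posSemidef_vecMulVec_self_star _).smul ?_)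
        · rw [Complex.zero_le_real]; linarith
        · rw [Complex.zero_le_real]; positivity
      · have h2 : (vecMulVec (star x) (star (star x))).trace = (r : ℂ) := by
          rw [trace_vecMulVec, star_star, hsq]
        rw [trace_add, trace_smul, trace_smul, htrXs, h2]
        have : (r : ℂ) ≠ 0 := by exact_mod_cast hrpos.ne'
        simp only [smul_eq_mul]
        push_cast
        field_simp
        ring)
    rw [Finset.sum_sub_distrib, ← Finset.mul_sum] at hS
    simp only [Finset.sum_const, Finset.card_univ, Fintype.card_fin, nsmul_eq_mul, mul_one] at hS
    have h3 : (n : ℝ) * (∑ i, Complex.normSq ((V *ᵥ x) i)) ≤ n * r := by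
      have : (n : ℝ) / r * (∑ i, Complex.normSq ((V *ᵥ x) i)) ≤ n := by linarith
      rwa [div_mul_eq_mul_div, div_le_iff₀ hrpos] at this
    exact le_of_mul_le_mul_left h3 hn
  refine ⟨?_, key⟩
  have h1 := posSemidef_conjTranspose_mul_self (1 - V * Vᴴ)
  have h2 := h1.add (key.mul_mul_conjTranspose_same V)
  convert h2 using 1
  simp only [conjTranspose_sub, conjTranspose_one, conjTranspose_mul, conjTranspose_conjTranspose]
  noncomm_ring
end

section
/- Let B ∈ ℂ^{n×n} be a Hermitian matrix with 0 ⪯ B ≺ I (i.e., B is positive semidefinite and I − B is positive definite). Then per(I + B) ≤ det((I − B)^{−1}) = 1/det(I − B). -/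
open scoped BigOperators ComplexOrder

namespace PermAux
open Matrix Finset

lemma perm_eq {n : ℕ} (A : Matrix (Fin n) (Fin n) ℂ) : perm A = A.permanent := by
  rw [← permanent_transpose]; rfl

/-- `k!` times the permanent of a Gram matrix is a sum of squared moduli. -/
lemma gram {ι κ : Type*} [Fintype ι] [DecidableEq ι] [Fintype κ] (C : Matrix κ ι ℂ) :
    (Fintype.card (Equiv.Perm ι) : ℂ) * (Cᴴ * C).permanent =
      ∑ f : ι → κ, star (C.submatrix f id).permanent * (C.submatrix f id).permanent := by
  classical
  have h1 : (Cᴴ * C).permanent =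
      ∑ f : ι → κ, star (C.submatrix f id).permanent * ∏ i, C (f i) i := by
    simp only [permanent, mul_apply, prod_univ_sum, Fintype.piFinset_univ]
    rw [sum_comm]
    refine sum_congr rfl fun f _ => ?_
    rw [star_sum, sum_mul, ← Equiv.sum_comp (Equiv.inv (Equiv.Perm ι))]
    refine sum_congr rfl fun σ _ => ?_
    rw [prod_mul_distrib, star_prod]
    congr 1
    rw [← Equiv.prod_comp σ]
    simp [conjTranspose_apply]
  have h2 : ∀ τ : Equiv.Perm ι, (Cᴴ * C).permanent =
      ∑ f : ι → κ, star (C.submatrix f id).permanent * ∏ i, C (f (τ i)) i := by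
    intro τ
    rw [h1, ← Equiv.sum_comp (Equiv.arrowCongr τ.symm (Equiv.refl κ))]
    refine sum_congr rfl fun f _ => ?_
    congr 2
    exact permanent_permute_cols τ (C.submatrix f id)
  calc _ = ∑ τ : Equiv.Perm ι, (Cᴴ * C).permanent := by simp
    _ = ∑ τ : Equiv.Perm ι, ∑ f : ι → κ, star (C.submatrix f id).permanent *
        ∏ i, C (f (τ i)) i := sum_congr rfl fun τ _ => h2 τ
    _ = _ := by
      rw [sum_comm]
      refine sum_congr rfl fun f _ => ?_
      rw [← mul_sum]; rfl

lemma permanent_nonneg {ι : Type*} [Fintype ι] [DecidableEq ι] {M : Matrix ι ι ℂ}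
    (hM : M.PosSemidef) : 0 ≤ M.permanent := by
  obtain ⟨C, rfl⟩ : ∃ C : Matrix ι ι ℂ, M = Cᴴ * C := by
    open scoped MatrixOrder in
    exact CStarAlgebra.nonneg_iff_eq_star_mul_self.mp hM.nonneg
  have h := gram C
  have h0 : (0:ℂ) ≤ (Fintype.card (Equiv.Perm ι) : ℂ) * (Cᴴ * C).permanent := by
    rw [h]
    exact sum_nonneg fun f _ => star_mul_self_nonneg _
  have hc : (0:ℂ) < (Fintype.card (Equiv.Perm ι) : ℂ) := by
    exact_mod_cast Fintype.card_pos
  refine le_of_mul_le_mul_left ?_ hc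
  rwa [mul_zero]

/-- Sum of the permanents of all `k`-tuples of indices. -/
noncomputable def W {ι : Type*} [Fintype ι] (k : ℕ) (A : Matrix ι ι ℂ) : ℂ :=
  ∑ f : Fin k → ι, (A.submatrix f f).permanent

lemma W_comm {ι : Type*} [Fintype ι] (k : ℕ) (A B : Matrix ι ι ℂ) :
    W k (A * B) = W k (B * A) := by
  classical
  have key : ∀ A B : Matrix ι ι ℂ, W k (A * B) =
      ∑ σ : Equiv.Perm (Fin k), ∑ f : Fin k → ι, ∑ g : Fin k → ι,
        ∏ i, (A (f (σ i)) (g i) * B (g i) (f i)) := by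
    intro A B
    simp only [W, permanent, mul_apply, submatrix_apply, prod_univ_sum, Fintype.piFinset_univ]
    rw [sum_comm]
  rw [key, key]
  refine sum_congr rfl fun σ _ => ?_
  conv_rhs => rw [sum_comm]
  rw [← Equiv.sum_comp (Equiv.arrowCongr σ (Equiv.refl ι))]
  refine sum_congr rfl fun f _ => sum_congr rfl fun g _ => ?_
  rw [prod_mul_distrib, prod_mul_distrib, mul_comm]
  congr 1
  · rw [← Equiv.prod_comp σ]
    simp
  · simp

lemma expand {ι : Type*} [Fintype ι] [DecidableEq ι] (B : Matrix ι ι ℂ) :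
    (1 + B).permanent = ∑ S ∈ (univ : Finset ι).powerset,
      (B.submatrix (Subtype.val : S → ι) Subtype.val).permanent := by
  simp only [permanent, Matrix.add_apply]
  simp_rw [add_comm ((1 : Matrix ι ι ℂ) _ _), prod_add]
  rw [sum_comm]
  refine sum_congr rfl fun S _ => ?_
  have h0 : ∀ σ : Equiv.Perm ι, (∏ i ∈ univ \ S, (1 : Matrix ι ι ℂ) (σ i) i) =
      if (∀ i, i ∉ S → σ i = i) then 1 else 0 := by
    intro σ
    split_ifs with h
    · exact prod_eq_one fun i hi => by
        rw [h i (by simpa using hi)]; simp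
    · push Not at h
      obtain ⟨i, hi, hne⟩ := h
      exact prod_eq_zero (i := i) (by simpa using hi) (by simp [one_apply, hne])
  simp_rw [h0, mul_ite, mul_one, mul_zero]
  rw [← sum_filter, ← sum_subtype_eq_sum_filter, subtype_univ]
  rw [← Equiv.sum_comp (Equiv.Perm.subtypeEquivSubtypePerm (· ∈ S))]
  refine sum_congr rfl fun σ _ => ?_
  rw [← prod_attach]
  refine prod_congr rfl fun i _ => ?_
  rw [Equiv.Perm.subtypeEquivSubtypePerm_apply_of_mem _ i.2]
  rfl

lemma subset_le {ι : Type*} [Fintype ι] [DecidableEq ι] {B : Matrix ι ι ℂ} (hB : B.PosSemidef)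
    (k : ℕ) : (k.factorial : ℂ) * ∑ S ∈ powersetCard k (univ : Finset ι),
      (B.submatrix (Subtype.val : S → ι) Subtype.val).permanent ≤ W k B := by
  have hnn : ∀ f : Fin k → ι, 0 ≤ (B.submatrix f f).permanent := fun f =>
    permanent_nonneg (hB.submatrix f)
  unfold W
  rw [mul_sum, ← sum_fiberwise (univ : Finset (Fin k → ι)) (fun f => univ.image f)]
  refine (sum_le_sum fun S hS => ?_).trans
    (sum_le_univ_sum_of_nonneg fun S => sum_nonneg fun f _ => hnn f)
  have hc : #S = k := (mem_powersetCard.mp hS).2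
  have e0 : Fin k ≃ S := (Fintype.equivFinOfCardEq (by simp [hc])).symm
  have hcard : Fintype.card (Fin k ≃ S) = k.factorial := by
    rw [Fintype.card_equiv e0]; simp
  let E : (Fin k ≃ S) ↪ (Fin k → ι) := ⟨fun e i => (e i : ι), fun e e' h => by
    ext i; exact congrFun h i⟩
  have hE : ∀ e i, E e i = (e i : ι) := fun _ _ => rfl
  calc (k.factorial : ℂ) * (B.submatrix (Subtype.val : S → ι) Subtype.val).permanent
      = ∑ e : Fin k ≃ S, (B.submatrix (E e) (E e)).permanent := by
        rw [← hcard, ← nsmul_eq_mul, ← card_univ, ← sum_const]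
        refine sum_congr rfl fun e _ => ?_
        unfold permanent
        rw [← Equiv.sum_comp e.permCongr]
        refine sum_congr rfl fun σ _ => ?_
        rw [← Equiv.prod_comp e]
        simp [hE, Equiv.permCongr_apply]
    _ = ∑ f ∈ univ.map E, (B.submatrix f f).permanent := by rw [sum_map]
    _ ≤ _ := by
      refine sum_le_sum_of_subset_of_nonneg ?_ fun f _ _ => hnn f
      intro f hf
      obtain ⟨e, -, rfl⟩ := mem_map.mp hf
      simp only [mem_filter, mem_univ, true_and]
      ext x
      simp only [mem_image, mem_univ, true_and, hE]
      constructor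
      · rintro ⟨i, rfl⟩; exact (e i).2
      · intro hx; exact ⟨e.symm ⟨x, hx⟩, by simp⟩

lemma stab_count {ι : Type*} [Fintype ι] [DecidableEq ι] (k : ℕ) (m : ι → ℕ) :
    ∑ f : Fin k → ι with (fun j => #{i | f i = j}) = m,
      #{σ : Equiv.Perm (Fin k) | f ∘ σ = f} ≤ k.factorial := by
  by_cases hne : ∃ f0 : Fin k → ι, (fun j => #{i | f0 i = j}) = m
  swap
  · rw [filter_eq_empty_iff.mpr]
    · simp
    · intro f _ h; exact hne ⟨f, h⟩
  obtain ⟨f0, h0⟩ := hne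
  have h1 : ∀ f : Fin k → ι, (fun j => #{i | f i = j}) = m →
      #{σ : Equiv.Perm (Fin k) | f ∘ σ = f} ≤ #{σ : Equiv.Perm (Fin k) | f0 ∘ σ = f} := by
    intro f hf
    have e : ∀ j, Nonempty ({i // f i = j} ≃ {i // f0 i = j}) := fun j => by
      refine ⟨Fintype.equivOfCardEq ?_⟩
      rw [Fintype.card_subtype, Fintype.card_subtype]
      exact congrFun (hf.trans h0.symm) j
    replace e := fun j => (e j).some
    let τ : Equiv.Perm (Fin k) := (Equiv.sigmaFiberEquiv f).symm.trans
      ((Equiv.sigmaCongrRight e).trans (Equiv.sigmaFiberEquiv f0))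
    have hτ : f0 ∘ τ = f := by
      ext i
      exact (e (f i) ⟨i, rfl⟩).2
    refine card_le_card_of_injOn (fun σ => τ * σ) ?_ ?_
    · intro σ hσ
      simp only [coe_filter, mem_univ, true_and, Set.mem_setOf_eq] at hσ ⊢
      rw [Equiv.Perm.coe_mul, ← Function.comp_assoc, hτ, hσ]
    · intro a _ b _ h; exact mul_left_cancel h
  calc _ ≤ ∑ f : Fin k → ι with (fun j => #{i | f i = j}) = m,
        #{σ : Equiv.Perm (Fin k) | f0 ∘ σ = f} := sum_le_sum fun f hf => h1 f (mem_filter.mp hf).2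
    _ ≤ ∑ f : Fin k → ι, #{σ : Equiv.Perm (Fin k) | f0 ∘ σ = f} :=
        sum_le_univ_sum_of_nonneg fun _ => Nat.zero_le _
    _ = k.factorial := by
      rw [← card_eq_sum_card_fiberwise (fun _ _ => mem_univ _), card_univ, Fintype.card_perm,
        Fintype.card_fin]

lemma W_diag_le {ι : Type*} [Fintype ι] [DecidableEq ι] (N k : ℕ) (hk : k ≤ N) (d : ι → ℂ)
    (hd : ∀ i, 0 ≤ d i) : W k (diagonal d) ≤ (k.factorial : ℂ) *
      ∑ m ∈ Fintype.piFinset (fun _ : ι => range (N + 1)) with ∑ i, m i = k, ∏ i, d i ^ m i := by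
  have h1 : ∀ f : Fin k → ι, ((diagonal d).submatrix f f).permanent =
      (#{σ : Equiv.Perm (Fin k) | f ∘ σ = f} : ℂ) * ∏ j, d j ^ #{i | f i = j} := by
    intro f
    have : ∀ σ : Equiv.Perm (Fin k), (∏ i, (diagonal d).submatrix f f (σ i) i) =
        if f ∘ σ = f then ∏ j, d j ^ #{i | f i = j} else 0 := by
      intro σ
      split_ifs with h
      · rw [← prod_fiberwise univ f]
        refine prod_congr rfl fun j _ => ?_
        rw [← prod_const]
        refine prod_congr rfl fun i hi => ?_
        have := congrFun h i
        simp only [Function.comp_apply] at this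
        rw [submatrix_apply, this, diagonal_apply_eq, (mem_filter.mp hi).2]
      · obtain ⟨i, hi⟩ := Function.ne_iff.mp h
        exact prod_eq_zero (mem_univ i) (diagonal_apply_ne _ hi)
    unfold permanent
    simp_rw [this]
    rw [← sum_filter, sum_const, nsmul_eq_mul]
  unfold W
  simp_rw [h1]
  rw [mul_sum, ← sum_fiberwise_of_maps_to (s := univ) (g := fun (f : Fin k → ι) j => #{i | f i = j})
    (t := {m ∈ Fintype.piFinset (fun _ : ι => range (N + 1)) | ∑ i, m i = k})]
  · refine sum_le_sum fun m _ => ?_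
    have h2 : ∀ f ∈ (univ : Finset (Fin k → ι)).filter (fun f => (fun j => #{i | f i = j}) = m),
        (#{σ : Equiv.Perm (Fin k) | f ∘ σ = f} : ℂ) * ∏ j, d j ^ #{i | f i = j} =
        (#{σ : Equiv.Perm (Fin k) | f ∘ σ = f} : ℂ) * ∏ j, d j ^ m j := by
      intro f hf
      have := (mem_filter.mp hf).2
      congr 1
      exact prod_congr rfl fun j _ => by rw [← congrFun this j]
    rw [sum_congr rfl h2, ← sum_mul]
    refine mul_le_mul_of_nonneg_right ?_ (prod_nonneg fun i _ => pow_nonneg (hd i) _)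
    exact_mod_cast stab_count k m
  · intro f _
    simp only [mem_filter, Fintype.mem_piFinset, mem_range]
    refine ⟨fun j => ?_, ?_⟩
    · have := card_le_univ (univ.filter fun i => f i = j)
      simp at this
      omega
    · have := card_eq_sum_card_fiberwise (s := univ) (t := univ) (f := f) (fun _ _ => mem_univ _)
      simpa using this.symm

lemma box_le {ι : Type*} [Fintype ι] [DecidableEq ι] (N : ℕ) (r : ι → ℝ)
    (hr : ∀ i, 0 ≤ r i) (hr1 : ∀ i, r i < 1) :
    ∑ k ∈ range (N + 1), ∑ m ∈ Fintype.piFinset (fun _ : ι => range (N + 1)) with ∑ i, m i = k,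
      ∏ i, r i ^ m i ≤ ∏ i, (1 - r i)⁻¹ := by
  have hnn : ∀ m : ι → ℕ, 0 ≤ ∏ i, r i ^ m i := fun m => prod_nonneg fun i _ => pow_nonneg (hr i) _
  calc _ ≤ ∑ m ∈ Fintype.piFinset (fun _ : ι => range (N + 1)), ∏ i, r i ^ m i :=
        sum_fiberwise_le_sum_of_sum_fiber_nonneg fun k _ => sum_nonneg fun m _ => hnn m
    _ = ∏ i, ∑ j ∈ range (N + 1), r i ^ j := by rw [prod_univ_sum]
    _ ≤ _ := by
      refine prod_le_prod (fun i _ => sum_nonneg fun j _ => pow_nonneg (hr i) _) fun i _ => ?_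
      rw [← tsum_geometric_of_lt_one (hr i) (hr1 i)]
      exact (summable_geometric_of_lt_one (hr i) (hr1 i)).sum_le_tsum _
        fun j _ => pow_nonneg (hr i) _

lemma main (n : ℕ) (B : Matrix (Fin n) (Fin n) ℂ) (hB : B.PosSemidef) (hBI : (1 - B).PosDef) :
    (1 + B).permanent ≤ ((1 - B).det)⁻¹ := by
  obtain ⟨U, r, hU, hU', hBU⟩ : ∃ (U : Matrix (Fin n) (Fin n) ℂ) (r : Fin n → ℝ),
      Uᴴ * U = 1 ∧ U * Uᴴ = 1 ∧ B = U * diagonal (fun i => (r i : ℂ)) * Uᴴ := by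
    refine ⟨hB.isHermitian.eigenvectorUnitary, hB.isHermitian.eigenvalues, ?_, ?_, ?_⟩
    · exact Unitary.coe_star_mul_self _
    · exact Unitary.coe_mul_star_self _
    · exact hB.isHermitian.spectral_theorem
  set D : Matrix (Fin n) (Fin n) ℂ := diagonal (fun i => (r i : ℂ)) with hD
  have hDB : Uᴴ * B * U = D := by
    rw [hBU]
    calc _ = (Uᴴ * U) * D * (Uᴴ * U) := by simp only [Matrix.mul_assoc]
      _ = D := by simp [hU]
  have hDI : Uᴴ * (1 - B) * U = diagonal (fun i => ((1 - r i : ℝ) : ℂ)) := by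
    rw [Matrix.mul_sub, Matrix.sub_mul, hDB, Matrix.mul_one, hU, hD, ← diagonal_one, diagonal_sub]
    simp
  have hr : ∀ i, 0 ≤ r i := by
    have := hB.conjTranspose_mul_mul_same U
    rw [hDB, hD, posSemidef_diagonal_iff] at this
    intro i; exact_mod_cast this i
  have hr1 : ∀ i, r i < 1 := by
    have hinj : Function.Injective U.mulVec := by
      intro x y h
      have := congrArg Uᴴ.mulVec h
      simpa [mulVec_mulVec, hU] using this
    have := hBI.conjTranspose_mul_mul_same hinj
    rw [hDI, posDef_diagonal_iff] at this
    intro i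
    have h := this i
    have : 0 < 1 - r i := by exact_mod_cast h
    linarith
  have hdet : (1 - B).det = ((∏ i, (1 - r i) : ℝ) : ℂ) := by
    have := congrArg det hDI
    rw [det_mul, det_mul, det_diagonal, mul_right_comm, ← det_mul, hU, det_one, one_mul] at this
    rw [this]; push_cast; rfl
  have hW : ∀ k, W k B = W k D := by
    intro k
    rw [hBU, W_comm, ← Matrix.mul_assoc, hU, Matrix.one_mul]
  have hk : ∀ k ∈ range (n + 1), ∑ S ∈ powersetCard k (univ : Finset (Fin n)),
      (B.submatrix (Subtype.val : S → Fin n) Subtype.val).permanent ≤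
      ∑ m ∈ Fintype.piFinset (fun _ : Fin n => range (n + 1)) with ∑ i, m i = k,
        ∏ i, (r i : ℂ) ^ m i := by
    intro k hk
    have h1 := subset_le hB k
    rw [hW] at h1
    have h2 := h1.trans (W_diag_le n k (by simpa [Nat.lt_succ_iff] using hk) (fun i => (r i : ℂ))
      fun i => by exact_mod_cast hr i)
    have hc : (0:ℂ) < (k.factorial : ℂ) := by exact_mod_cast k.factorial_pos
    exact le_of_mul_le_mul_left h2 hc
  rw [expand, sum_powerset, card_univ, Fintype.card_fin, hdet]
  refine (sum_le_sum hk).trans ?_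
  have := box_le n r hr hr1
  rw [prod_inv_distrib] at this
  exact_mod_cast this

end PermAux

/-- If `B` is Hermitian with `0 ⪯ B ≺ I`, then
`per(I + B) ≤ det((I - B)⁻¹) = 1 / det(I - B)`. -/
theorem stmt_10 (n : ℕ) (B : Matrix (Fin n) (Fin n) ℂ)
    (hHerm : B.IsHermitian) (hB : B.PosSemidef)
    (hBI : ((1 : Matrix (Fin n) (Fin n) ℂ) - B).PosDef) :
    (perm ((1 : Matrix (Fin n) (Fin n) ℂ) + B)).re ≤
        (((1 : Matrix (Fin n) (Fin n) ℂ) - B)⁻¹).det.re ∧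
      (((1 : Matrix (Fin n) (Fin n) ℂ) - B)⁻¹).det =
        (((1 : Matrix (Fin n) (Fin n) ℂ) - B).det)⁻¹ := by
  have h : (((1 : Matrix (Fin n) (Fin n) ℂ) - B)⁻¹).det =
      (((1 : Matrix (Fin n) (Fin n) ℂ) - B).det)⁻¹ := by
    rw [Matrix.det_nonsing_inv, Ring.inverse_eq_inv']
  refine ⟨?_, h⟩
  rw [h, PermAux.perm_eq]
  exact (Complex.le_def.mp (PermAux.main n B hB hBI)).1
end

section
/- Let F ∈ {ℝ, ℂ} and let f : ℝ_{>0} → ℝ be a continuous, injective, increasing, 2-concave function (with f(|t|) interpreted as the limit value f(0⁺) ∈ [−∞, ∞) when t = 0). Let E ∈ F^{m×k} be a matrix all of whose entries have magnitude 1/√k and with ‖E‖_{2→2} = 1. Let P ∈ F^{nk×nk} be the orthogonal projection onto a subspace W ⊆ F^{n×k} ≅ F^{nk}, and set A = (I_n ⊗ E)·P. If there exists x ∈ W such that for every i ∈ [n] the i-th block x_i ∈ F^k is a standard basis vector, then [A]_{2→f} = 1. -/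
open scoped BigOperators ENNReal
open Matrix Kronecker

/-- The value `f(t)` as an extended real, where the value at `t ≤ 0` is the prescribed
limit value `L = f(0⁺) ∈ [−∞, ∞)`. -/
noncomputable def fE (f : ℝ → ℝ) (L : EReal) (t : ℝ) : EReal :=
  if t ≤ 0 then L else (f t : EReal)

/-- The normalized 2-norm `‖x‖₂ = (average of |xᵢ|²)^{1/2}`. -/
noncomputable def norm2 {𝕜 : Type*} [RCLike 𝕜] {ι : Type*} [Fintype ι] (x : ι → 𝕜) : ℝ :=
  Real.sqrt ((∑ i, ‖x i‖ ^ 2) / (Fintype.card ι))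

theorem aux_supergrad (g : ℝ → ℝ) (hg : ConcaveOn ℝ (Set.Ioi (0 : ℝ)) g) (a : ℝ) (ha : 0 < a) :
    ∃ s : ℝ, ∀ x, 0 < x → g x ≤ g a + s * (x - a) := by
  set S : Set ℝ := {t | ∃ z, a < z ∧ t = (g z - g a) / (z - a)} with hS
  have hub : ∀ x, 0 < x → x < a → ∀ t ∈ S, t ≤ (g a - g x) / (a - x) := by
    rintro x hx hxa t ⟨z, hz, rfl⟩
    exact hg.slope_anti_adjacent (Set.mem_Ioi.2 hx) (Set.mem_Ioi.2 (ha.trans hz)) hxa hz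
  have hne : S.Nonempty := ⟨_, a + 1, by linarith, rfl⟩
  have hbdd : BddAbove S := ⟨_, hub (a / 2) (by linarith) (by linarith)⟩
  refine ⟨sSup S, fun x hx => ?_⟩
  rcases lt_trichotomy x a with h | h | h
  · have h1 := csSup_le hne (hub x hx h)
    rw [le_div_iff₀ (by linarith)] at h1
    linarith
  · subst h; simp
  · have h1 := le_csSup hbdd (⟨x, h, rfl⟩ : (g x - g a) / (x - a) ∈ S)
    rw [div_le_iff₀ (by linarith)] at h1
    linarith

theorem aux_coe_sum {ι : Type*} (s : Finset ι) (h : ι → ℝ) :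
    (∑ i ∈ s, (h i : EReal)) = ((∑ i ∈ s, h i : ℝ) : EReal) := by
  classical
  induction s using Finset.induction_on with
  | empty => simp
  | insert a s ha ih => rw [Finset.sum_insert ha, Finset.sum_insert ha, ih, EReal.coe_add]

theorem aux_jensen (f : ℝ → ℝ) (L : EReal)
    (hf_mono : StrictMonoOn f (Set.Ioi (0 : ℝ)))
    (hf_conc : ConcaveOn ℝ (Set.Ioi (0 : ℝ)) (fun x => f (Real.sqrt x)))
    (hL : Filter.Tendsto (fun t : ℝ => (f t : EReal)) (nhdsWithin 0 (Set.Ioi 0)) (nhds L))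
    {ι : Type*} [Fintype ι] (z : ι → ℝ) (hz : ∀ i, 0 ≤ z i) (c : ℝ) (hc : 0 < c)
    (hsum : ∑ i, z i ^ 2 ≤ (Fintype.card ι) * c ^ 2) :
    ∑ i, fE f L (z i) ≤ (((Fintype.card ι : ℝ) * f c : ℝ) : EReal) := by
  obtain ⟨s, hs⟩ := aux_supergrad _ hf_conc (c ^ 2) (by positivity)
  have hs' : ∀ t, 0 < t → f t ≤ f c + s * (t ^ 2 - c ^ 2) := by
    intro t ht
    have := hs (t ^ 2) (by positivity)
    simpa only [Real.sqrt_sq ht.le, Real.sqrt_sq hc.le] using this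
  have hs0 : 0 ≤ s := by
    have h1 := hs' (c + 1) (by linarith)
    have h2 := hf_mono (Set.mem_Ioi.2 hc) (Set.mem_Ioi.2 (by linarith : 0 < c + 1)) (by linarith)
    by_contra h
    push Not at h
    nlinarith
  have hs0L : L ≤ ((f c + s * (0 ^ 2 - c ^ 2) : ℝ) : EReal) := by
    have hcont : Continuous fun t : ℝ => ((f c + s * (t ^ 2 - c ^ 2) : ℝ) : EReal) :=
      continuous_coe_real_ereal.comp (by fun_prop)
    refine le_of_tendsto_of_tendsto hL ((hcont.tendsto 0).mono_left nhdsWithin_le_nhds) ?_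
    filter_upwards [self_mem_nhdsWithin] with t ht
    exact EReal.coe_le_coe_iff.2 (hs' t ht)
  have hE : ∀ i, fE f L (z i) ≤ ((f c + s * (z i ^ 2 - c ^ 2) : ℝ) : EReal) := by
    intro i
    unfold fE
    split_ifs with h
    · have h0 : z i = 0 := le_antisymm h (hz i)
      rw [h0]; exact hs0L
    · exact EReal.coe_le_coe_iff.2 (hs' _ (not_le.1 h))
  refine (Finset.sum_le_sum fun i _ => hE i).trans ?_
  rw [aux_coe_sum, EReal.coe_le_coe_iff, Finset.sum_add_distrib, ← Finset.mul_sum,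
    Finset.sum_sub_distrib]
  simp only [Finset.sum_const, Finset.card_univ, nsmul_eq_mul]
  nlinarith

theorem aux_proj {𝕜 : Type*} [RCLike 𝕜] {ι : Type*} [Fintype ι] (P : Matrix ι ι 𝕜)
    (hP : P.IsHermitian) (hPP : P * P = P) (y : ι → 𝕜) :
    ∑ i, ‖(P *ᵥ y) i‖ ^ 2 ≤ ∑ i, ‖y i‖ ^ 2 := by
  have horth : star (P *ᵥ y) ⬝ᵥ (y - P *ᵥ y) = 0 := by
    rw [Matrix.star_mulVec, hP.eq, ← Matrix.dotProduct_mulVec, Matrix.mulVec_sub,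
      Matrix.mulVec_mulVec, hPP, sub_self, dotProduct_zero]
  have hre : ∑ i, RCLike.re (inner 𝕜 ((P *ᵥ y) i) ((y - P *ᵥ y) i)) = 0 := by
    rw [← map_sum]
    have : ∑ i, inner 𝕜 ((P *ᵥ y) i) ((y - P *ᵥ y) i) = star (P *ᵥ y) ⬝ᵥ (y - P *ᵥ y) := by
      unfold dotProduct
      refine Finset.sum_congr rfl fun i _ => ?_
      rw [RCLike.inner_apply, mul_comm]; rfl
    rw [this, horth, map_zero]
  have hi : ∀ i, ‖y i‖ ^ 2 = ‖(P *ᵥ y) i‖ ^ 2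
      + 2 * RCLike.re (inner 𝕜 ((P *ᵥ y) i) ((y - P *ᵥ y) i)) + ‖(y - P *ᵥ y) i‖ ^ 2 := by
    intro i
    rw [← norm_add_sq (𝕜 := 𝕜)]
    simp
  rw [Finset.sum_congr rfl fun i _ => hi i, Finset.sum_add_distrib, Finset.sum_add_distrib,
    ← Finset.mul_sum, hre]
  have : 0 ≤ ∑ i, ‖(y - P *ᵥ y) i‖ ^ 2 := by positivity
  linarith

theorem aux_sum_pos {𝕜 : Type*} [RCLike 𝕜] {ι : Type*} [Fintype ι] (y : ι → 𝕜) (hy : y ≠ 0) :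
    0 < ∑ i, ‖y i‖ ^ 2 := by
  obtain ⟨i, hi⟩ := Function.ne_iff.1 hy
  refine Finset.sum_pos' (fun i _ => by positivity) ⟨i, Finset.mem_univ _, ?_⟩
  have : 0 < ‖y i‖ := norm_pos_iff.2 hi
  positivity

theorem aux_E {𝕜 : Type*} [RCLike 𝕜] (k m : ℕ) (hk : 1 ≤ k) (hm : 1 ≤ m)
    (E : Matrix (Fin m) (Fin k) 𝕜)
    (hEnorm : sSup {t : ℝ | ∃ x : Fin k → 𝕜, x ≠ 0 ∧ t = norm2 (E *ᵥ x) / norm2 x} = 1)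
    (x : Fin k → 𝕜) : (k : ℝ) * ∑ i, ‖(E *ᵥ x) i‖ ^ 2 ≤ m * ∑ i, ‖x i‖ ^ 2 := by
  by_cases hx : x = 0
  · simp [hx]
  have hk' : (0 : ℝ) < k := by exact_mod_cast hk
  have hm' : (0 : ℝ) < m := by exact_mod_cast hm
  have hb : BddAbove {t : ℝ | ∃ x : Fin k → 𝕜, x ≠ 0 ∧ t = norm2 (E *ᵥ x) / norm2 x} := by
    by_contra h
    rw [Real.sSup_of_not_bddAbove h] at hEnorm
    exact zero_ne_one hEnorm
  have h1 := le_csSup hb ⟨x, hx, rfl⟩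
  have hp := aux_sum_pos x hx
  have hnp : 0 < norm2 x := by
    unfold norm2
    rw [Fintype.card_fin]
    positivity
  rw [hEnorm, div_le_one hnp] at h1
  unfold norm2 at h1
  rw [Real.sqrt_le_sqrt_iff (by positivity), Fintype.card_fin, Fintype.card_fin,
    div_le_div_iff₀ hm' hk'] at h1
  linarith

theorem aux_kron {𝕜 : Type*} [RCLike 𝕜] (n k m : ℕ) (E : Matrix (Fin m) (Fin k) 𝕜)
    (u : Fin n × Fin k → 𝕜) (i : Fin n) (r : Fin m) :
    (((1 : Matrix (Fin n) (Fin n) 𝕜) ⊗ₖ E) *ᵥ u) (i, r) = (E *ᵥ fun j => u (i, j)) r := by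
  simp [Matrix.mulVec, dotProduct, Fintype.sum_prod_type, Matrix.one_apply]

/-- **Completeness of the reduction.** Let `f : ℝ_{>0} → ℝ` be continuous, injective,
increasing and 2-concave (with limit value `L = f(0⁺) ∈ [−∞,∞)` at `0`). Let
`E ∈ 𝕜^{m×k}` have all entries of magnitude `1/√k` and `‖E‖_{2→2} = 1`, let `P` be the
orthogonal projection onto a subspace `W ⊆ 𝕜^{n×k}`, and set `A = (Iₙ ⊗ E)·P`. If
there is `x ∈ W` all of whose blocks are standard basis vectors, then `[A]_{2→f} = 1`,
i.e. `[Ay]_f ≤ ‖y‖₂` for all `y ≠ 0` (equivalently `avgᵥ f(|(Ay)ᵥ|) ≤ f(‖y‖₂)`), with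
equality attained by some `y ≠ 0`. -/
theorem stmt_13 (𝕜 : Type) [RCLike 𝕜]
    (f : ℝ → ℝ) (L : EReal)
    (hf_cont : ContinuousOn f (Set.Ioi (0 : ℝ)))
    (hf_mono : StrictMonoOn f (Set.Ioi (0 : ℝ)))
    (hf_conc : ConcaveOn ℝ (Set.Ioi (0 : ℝ)) (fun x => f (Real.sqrt x)))
    (hL : Filter.Tendsto (fun t : ℝ => (f t : EReal)) (nhdsWithin 0 (Set.Ioi 0)) (nhds L))
    (hLne : L ≠ ⊤)
    (n k m : ℕ) (hn : 1 ≤ n) (hk : 1 ≤ k) (hm : 1 ≤ m)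
    (E : Matrix (Fin m) (Fin k) 𝕜)
    (hEentries : ∀ i j, ‖E i j‖ = 1 / Real.sqrt k)
    (hEnorm : sSup {t : ℝ | ∃ x : Fin k → 𝕜, x ≠ 0 ∧ t = norm2 (E *ᵥ x) / norm2 x} = 1)
    (P : Matrix (Fin n × Fin k) (Fin n × Fin k) 𝕜)
    (hP : P.IsHermitian) (hPP : P * P = P)
    (hx : ∃ x : Fin n × Fin k → 𝕜, P *ᵥ x = x ∧
      ∀ i : Fin n, ∃ b : Fin k, ∀ j, x (i, j) = if j = b then 1 else 0) :
    (∀ y : Fin n × Fin k → 𝕜, y ≠ 0 →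
      (∑ v : Fin n × Fin m,
          fE f L ‖((((1 : Matrix (Fin n) (Fin n) 𝕜) ⊗ₖ E) * P) *ᵥ y) v‖) ≤
        (((n * m : ℕ) : ℝ) : EReal) * ((f (norm2 y) : ℝ) : EReal)) ∧
    (∃ y : Fin n × Fin k → 𝕜, y ≠ 0 ∧
      (∑ v : Fin n × Fin m,
          fE f L ‖((((1 : Matrix (Fin n) (Fin n) 𝕜) ⊗ₖ E) * P) *ᵥ y) v‖) =
        (((n * m : ℕ) : ℝ) : EReal) * ((f (norm2 y) : ℝ) : EReal)) := by
  have hk' : (0 : ℝ) < k := by exact_mod_cast hk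
  have hm' : (0 : ℝ) < m := by exact_mod_cast hm
  have hn' : (0 : ℝ) < n := by exact_mod_cast hn
  constructor
  · intro y hy
    have hp := aux_sum_pos y hy
    have hc : 0 < norm2 y := by
      unfold norm2
      rw [Fintype.card_prod, Fintype.card_fin, Fintype.card_fin]
      push_cast
      positivity
    have hc2 : norm2 y ^ 2 = (∑ i, ‖y i‖ ^ 2) / (n * k) := by
      unfold norm2
      rw [Real.sq_sqrt (by positivity)]
      simp
    have key := aux_jensen f L hf_mono hf_conc hL
      (fun v : Fin n × Fin m => ‖((((1 : Matrix (Fin n) (Fin n) 𝕜) ⊗ₖ E) * P) *ᵥ y) v‖)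
      (fun _ => norm_nonneg _) (norm2 y) hc ?_
    · rw [← EReal.coe_mul]
      simpa using key
    · have hpr := aux_proj P hP hPP y
      simp only [← Matrix.mulVec_mulVec]
      rw [hc2, Fintype.sum_prod_type]
      simp only [aux_kron]
      set u := P *ᵥ y
      have h1 : (k : ℝ) * ∑ i : Fin n, ∑ r, ‖(E *ᵥ fun j => u (i, j)) r‖ ^ 2
          ≤ m * ∑ i : Fin n × Fin k, ‖u i‖ ^ 2 := by
        rw [Fintype.sum_prod_type, Finset.mul_sum, Finset.mul_sum]
        exact Finset.sum_le_sum fun i _ => aux_E k m hk hm E hEnorm _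
      have h2 := h1.trans (mul_le_mul_of_nonneg_left hpr hm'.le)
      have h3 : ((Fintype.card (Fin n × Fin m) : ℕ) : ℝ) * ((∑ i, ‖y i‖ ^ 2) / (n * k))
          = (m * ∑ i, ‖y i‖ ^ 2) / k := by
        simp only [Fintype.card_prod, Fintype.card_fin]
        push_cast
        field_simp
      rw [h3, le_div_iff₀ hk']
      linarith
  · obtain ⟨x, hPx, hxb⟩ := hx
    choose b hb using hxb
    have hs : ∑ v, ‖x v‖ ^ 2 = n := by
      rw [Fintype.sum_prod_type]
      have : ∀ i j, ‖x (i, j)‖ ^ 2 = if j = b i then (1 : ℝ) else 0 := by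
        intro i j; rw [hb]; split_ifs <;> simp
      simp [this]
    have hnorm : norm2 x = 1 / Real.sqrt k := by
      unfold norm2
      rw [hs, Fintype.card_prod, Fintype.card_fin, Fintype.card_fin, one_div, ← Real.sqrt_inv]
      congr 1
      push_cast
      field_simp
    refine ⟨x, ?_, ?_⟩
    · rintro rfl
      simp at hs
      linarith
    · have hv : ∀ v : Fin n × Fin m,
          fE f L ‖((((1 : Matrix (Fin n) (Fin n) 𝕜) ⊗ₖ E) * P) *ᵥ x) v‖
            = ((f (norm2 x) : ℝ) : EReal) := by
        rintro ⟨i, r⟩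
        rw [← Matrix.mulVec_mulVec, hPx, aux_kron]
        have : (E *ᵥ fun j => x (i, j)) r = E r (b i) := by
          simp [Matrix.mulVec, dotProduct, hb]
        rw [this, hEentries, hnorm]
        unfold fE
        rw [if_neg (not_le.2 (by positivity))]
      rw [Finset.sum_congr rfl fun v _ => hv v, aux_coe_sum, ← EReal.coe_mul]
      simp
end
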